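/- arXiv:1210.4346 — 2 statements merged into one kernel-verified Lean document; each statement's English description precedes it below -/
import Mathlib

section
/- Let n ≥ 1 and let f₁, …, fₙ ∈ QC₀(ℝⁿ) have compact superlevel sets for every t ∈ (0,1], and assume ∫_{ℝⁿ}(f₁ ⊕ f₂ ⊕ ⋯ ⊕ fₙ) < ∞. Then ∫(⊕_{i∈S} fᵢ) < ∞ and ∫(⊕_{i∈S} fᵢ*) < ∞ for every nonempty S ⊆ {1,…,n}, and the mixed integrals satisfy V(f₁, f₂, …, fₙ) ≥ V(f₁*, f₂*, …, fₙ*). -/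
open MeasureTheory ENNReal Filter Topology

noncomputable section

abbrev En (n : ℕ) := EuclideanSpace ℝ (Fin n)

def QuasiConcave {n : ℕ} (f : En n → ℝ≥0∞) : Prop :=
  ∀ x y : En n, ∀ l : ℝ, 0 < l → l < 1 →
    min (f x) (f y) ≤ f (l • x + (1 - l) • y)

def QC {n : ℕ} (f : En n → ℝ≥0∞) : Prop :=
  UpperSemicontinuous f ∧ QuasiConcave f ∧ ∀ x, f x ≠ ∞

def QC0 {n : ℕ} (f : En n → ℝ≥0∞) : Prop :=
  QC f ∧ f 0 = 1 ∧ ∀ x, f x ≤ 1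

/-- The symmetric decreasing rearrangement. -/
def fstar {n : ℕ} (f : En n → ℝ≥0∞) : En n → ℝ≥0∞ :=
  fun x => sSup {t : ℝ≥0∞ | t ≤ 1 ∧
    volume (Metric.closedBall (0 : En n) ‖x‖) ≤ volume {y : En n | t ≤ f y}}

/-- `(⊕_{i ∈ S} gᵢ)(x) = sup { min_{i ∈ S} gᵢ(yᵢ) : ∑_{i ∈ S} yᵢ = x }`. -/
def oplusFinset {n m : ℕ} (S : Finset (Fin m)) (f : Fin m → En n → ℝ≥0∞) :
    En n → ℝ≥0∞ :=
  fun x => ⨆ (y : Fin m → En n) (_ : ∑ i ∈ S, y i = x), ⨅ i ∈ S, f i (y i)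

/-- The mixed integral, as the polarization
`V(f₁,…,fₙ) = (1/n!) ∑_{∅ ≠ S ⊆ [n]} (−1)^{n−|S|} ∫ ⊕_{i∈S} fᵢ`. -/
def mixedInt {n : ℕ} (f : Fin n → En n → ℝ≥0∞) : ℝ :=
  (n.factorial : ℝ)⁻¹ *
    ∑ S ∈ Finset.univ.powerset.filter (fun S : Finset (Fin n) => S.Nonempty),
      (-1 : ℝ) ^ (n - S.card) * (∫⁻ x, oplusFinset S f x).toReal

open scoped Pointwise

/-- The alternating sum over subsets which polarizes a homogeneous polynomial of degree `n`. -/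
noncomputable def altSum {n : ℕ} (F : Finset (Fin n) → ℝ) : ℝ :=
  ∑ S : Finset (Fin n), (-1 : ℝ) ^ (n - S.card) * F S

/-- `n!` times the mixed discriminant. -/
noncomputable def mixedDisc {n : ℕ} (A : Fin n → Matrix (Fin n) (Fin n) ℝ) : ℝ :=
  altSum fun S => (∑ i ∈ S, A i).det

theorem altSum_sum_piFinset {n : ℕ} (g : (Fin n → Fin n) → ℝ) :
    altSum (fun S => ∑ σ ∈ Fintype.piFinset (fun _ : Fin n => S), g σ) =
      ∑ σ : Equiv.Perm (Fin n), g σ := by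
  have h1 : altSum (fun S => ∑ σ ∈ Fintype.piFinset (fun _ : Fin n => S), g σ) =
      ∑ σ : Fin n → Fin n, g σ * ∑ S ∈ (Finset.univ : Finset (Finset (Fin n))) with
        Finset.univ.image σ ⊆ S, (-1 : ℝ) ^ (n - S.card) := by
    unfold altSum
    simp_rw [Finset.mul_sum]
    rw [Finset.sum_comm' (t' := Finset.univ)
      (s' := fun σ => Finset.univ.filter fun S => Finset.univ.image σ ⊆ S)]
    · exact Finset.sum_congr rfl fun σ _ => Finset.sum_congr rfl fun S _ => mul_comm _ _
    · intro S σ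
      simp [Fintype.mem_piFinset, Finset.image_subset_iff]
  have h2 : ∀ σ : Fin n → Fin n, ∑ S ∈ (Finset.univ : Finset (Finset (Fin n))) with
        Finset.univ.image σ ⊆ S, (-1 : ℝ) ^ (n - S.card) =
      if Function.Bijective σ then 1 else 0 := by
    intro σ
    have h3 : ∑ S ∈ (Finset.univ : Finset (Finset (Fin n))) with
        Finset.univ.image σ ⊆ S, (-1 : ℝ) ^ (n - S.card) =
        ∑ T ∈ (Finset.univ.image σ)ᶜ.powerset, (-1 : ℝ) ^ T.card := by
      refine Finset.sum_nbij' (fun S => Sᶜ) (fun T => Tᶜ) ?_ ?_ ?_ ?_ ?_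
      · intro S hS
        simpa using hS
      · intro T hT
        simp only [Finset.mem_powerset] at hT
        simp only [Finset.mem_filter, Finset.mem_univ, true_and]
        exact Finset.subset_compl_comm.mp hT
      · simp
      · simp
      · intro S _
        rw [Finset.card_compl, Fintype.card_fin]
    rw [h3]
    have h4 := Finset.sum_powerset_neg_one_pow_card (x := (Finset.univ.image σ)ᶜ)
    have h5 : (∑ T ∈ (Finset.univ.image σ)ᶜ.powerset, (-1 : ℝ) ^ T.card) =
        ((∑ T ∈ (Finset.univ.image σ)ᶜ.powerset, (-1 : ℤ) ^ T.card : ℤ) : ℝ) := by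
      push_cast; rfl
    rw [h5, h4]
    have h6 : (Finset.univ.image σ)ᶜ = ∅ ↔ Function.Bijective σ := by
      rw [Finset.compl_eq_empty_iff, ← Finite.surjective_iff_bijective]
      simp [Finset.eq_univ_iff_forall, Function.Surjective]
    by_cases hb : Function.Bijective σ
    · rw [if_pos (h6.mpr hb), if_pos hb]; simp
    · rw [if_neg (fun h => hb (h6.mp h)), if_neg hb]; simp
  rw [h1]
  simp_rw [h2, mul_ite, mul_one, mul_zero]
  rw [← Finset.sum_filter]
  symm
  refine Finset.sum_bij (fun (σ : Equiv.Perm (Fin n)) _ => (σ : Fin n → Fin n)) ?_ ?_ ?_ ?_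
  · intro σ _
    exact Finset.mem_filter.mpr ⟨Finset.mem_univ _, σ.bijective⟩
  · intro σ _ τ _ h; exact DFunLike.coe_injective h
  · intro σ hσ
    exact ⟨Equiv.ofBijective σ (Finset.mem_filter.mp hσ).2, Finset.mem_univ _, rfl⟩
  · intros; rfl

theorem mixedDisc_eq_sum_perm {n : ℕ} (A : Fin n → Matrix (Fin n) (Fin n) ℝ) :
    mixedDisc A =
      ∑ σ : Equiv.Perm (Fin n), Matrix.det (Matrix.of fun r => A (σ r) r) := by
  rw [← altSum_sum_piFinset (fun σ => Matrix.det (Matrix.of fun r => A (σ r) r))]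
  unfold mixedDisc
  congr 1
  ext S
  have h := (Matrix.detRowAlternating (n := Fin n) (R := ℝ)).toMultilinearMap.map_sum_finset
    (fun r i => A i r) (fun _ => S)
  have h' : (∑ i ∈ S, A i).det = Matrix.detRowAlternating fun r => ∑ j ∈ S, A j r := by
    show _ = Matrix.det (Matrix.of fun r => ∑ j ∈ S, A j r)
    congr 1
    ext r c
    simp [Matrix.sum_apply]
  exact h'.trans h

open scoped MatrixOrder in
theorem mixedDisc_nonneg {n : ℕ} (A : Fin n → Matrix (Fin n) (Fin n) ℝ)
    (hA : ∀ i, (A i).PosSemidef) : 0 ≤ mixedDisc A := by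
  have hB : ∀ i, ∃ B : Matrix (Fin n) (Fin n) ℝ, ∀ r c, A i r c = ∑ k, B k r * B k c := by
    intro i
    obtain ⟨X, hX, -, h⟩ := CFC.exists_sqrt_of_isSelfAdjoint_of_quasispectrumRestricts
      (hA i).isHermitian (QuasispectrumRestricts.nnreal_of_nonneg (hA i).nonneg)
    refine ⟨X, fun r c => ?_⟩
    have hX' : X.transpose = X := by
      simpa [Matrix.star_eq_conjTranspose] using hX.star_eq
    rw [← h, Matrix.mul_apply]
    refine Finset.sum_congr rfl fun k _ => ?_
    rw [← Matrix.transpose_apply X r k, hX']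
  choose B hB using hB
  have key : mixedDisc A =
      ∑ k : Fin n → Fin n, (Matrix.det (Matrix.of fun i => B i (k i))) ^ 2 := by
    rw [mixedDisc_eq_sum_perm]
    have h1 : ∀ σ : Equiv.Perm (Fin n), Matrix.det (Matrix.of fun r => A (σ r) r) =
        ∑ k : Fin n → Fin n, (∏ r, B (σ r) (k (σ r)) r) *
          (Equiv.Perm.sign σ * Matrix.det (Matrix.of fun i => B i (k i))) := by
      intro σ
      have h := (Matrix.detRowAlternating (n := Fin n) (R := ℝ)).toMultilinearMap.map_sum
        (fun r (k : Fin n) => (B (σ r) k r) • (B (σ r) k))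
      have h' : Matrix.det (Matrix.of fun r => A (σ r) r) = ∑ k : Fin n → Fin n,
          Matrix.det (Matrix.of fun r => (B (σ r) (k r) r) • (B (σ r) (k r))) := by
        have h0 : Matrix.det (Matrix.of fun r => A (σ r) r) = Matrix.detRowAlternating
            fun r => ∑ k, (B (σ r) k r) • (B (σ r) k) := by
          show _ = Matrix.det (Matrix.of fun r => ∑ k, (B (σ r) k r) • (B (σ r) k))
          congr 1
          ext r c
          simp [hB]
        exact h0.trans h
      rw [h']
      rw [← Equiv.sum_comp (Equiv.arrowCongr σ.symm (Equiv.refl (Fin n)))]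
      refine Finset.sum_congr rfl fun k _ => ?_
      have h2 := (Matrix.detRowAlternating (n := Fin n) (R := ℝ)).toMultilinearMap.map_smul_univ
        (fun r => B (σ r) (k (σ r)) r) (fun r => B (σ r) (k (σ r)))
      have h3 := Matrix.det_permute σ (Matrix.of fun i => B i (k i))
      rw [← h3]
      exact h2
    simp_rw [h1]
    rw [Finset.sum_comm]
    refine Finset.sum_congr rfl fun k _ => ?_
    rw [sq]
    nth_rewrite 2 [Matrix.det_apply']
    rw [Finset.sum_mul]
    refine Finset.sum_congr rfl fun σ _ => ?_
    simp only [Matrix.of_apply]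
    ring
  rw [key]
  exact Finset.sum_nonneg fun k _ => sq_nonneg _

theorem mixedDisc_diagonal {n : ℕ} (d : Fin n → Fin n → ℝ) :
    mixedDisc (fun i => Matrix.diagonal (d i)) =
      ∑ σ : Equiv.Perm (Fin n), ∏ r, d (σ r) r := by
  rw [mixedDisc_eq_sum_perm]
  refine Finset.sum_congr rfl fun σ _ => ?_
  rw [← Matrix.det_diagonal]
  rfl

theorem altSum_prod_sum {n : ℕ} (d : Fin n → Fin n → ℝ) :
    altSum (fun S => ∏ r, ∑ i ∈ S, d i r) = ∑ σ : Equiv.Perm (Fin n), ∏ r, d (σ r) r := by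
  rw [← mixedDisc_diagonal, mixedDisc]
  congr 1
  ext S
  rw [← Matrix.det_diagonal]
  congr 1
  ext r c
  by_cases h : r = c
  · subst h; simp [Matrix.sum_apply]
  · simp [Matrix.diagonal_apply_ne _ h, Matrix.sum_apply]

theorem altSum_pow_sum {n : ℕ} (ρ : Fin n → ℝ) :
    altSum (fun S => (∑ i ∈ S, ρ i) ^ n) = n.factorial * ∏ i, ρ i := by
  have h := altSum_prod_sum (fun i (_ : Fin n) => ρ i)
  simp only [Finset.prod_const, Finset.card_univ, Fintype.card_fin] at h
  rw [h]
  have : ∀ σ : Equiv.Perm (Fin n), ∏ r, ρ (σ r) = ∏ r, ρ r := fun σ => Equiv.prod_comp σ ρ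
  simp [this, Fintype.card_perm]

/-- The arithmetic-geometric mean inequality for the permanent. -/
theorem factorial_mul_prod_rpow_le_sum_perm {n : ℕ} (d : Fin n → Fin n → ℝ)
    (hd : ∀ i r, 0 ≤ d i r) :
    n.factorial * ∏ i, (∏ r, d i r) ^ ((n : ℝ)⁻¹) ≤ ∑ σ : Equiv.Perm (Fin n), ∏ r, d (σ r) r := by
  rcases Nat.eq_zero_or_pos n with rfl | hn
  · simp
  have hfac : (0 : ℝ) < n.factorial := by exact_mod_cast n.factorial_pos
  have hcard : ∀ i r : Fin n, ((Finset.univ : Finset (Equiv.Perm (Fin n))).filter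
      fun σ => σ r = i).card = (n - 1).factorial := by
    intro i r
    have h1 : ∀ j : Fin n, ((Finset.univ : Finset (Equiv.Perm (Fin n))).filter
        fun σ => σ r = j).card = ((Finset.univ : Finset (Equiv.Perm (Fin n))).filter
        fun σ => σ r = i).card := by
      intro j
      refine Finset.card_bij' (fun σ _ => Equiv.swap i j * σ) (fun σ _ => Equiv.swap i j * σ)
        ?_ ?_ ?_ ?_
      · intro σ hσ
        simp at hσ
        simp [hσ]
      · intro σ hσ
        simp at hσ
        simp [hσ]
      · intro σ _; simp
      · intro σ _; simp
    have h2 := Finset.card_eq_sum_card_fiberwise (s := (Finset.univ : Finset (Equiv.Perm (Fin n))))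
      (t := (Finset.univ : Finset (Fin n))) (f := fun σ => σ r) (fun _ _ => Finset.mem_univ _)
    simp only [h1] at h2
    rw [Finset.sum_const, Finset.card_univ, Finset.card_univ, Fintype.card_perm,
      Fintype.card_fin, smul_eq_mul] at h2
    have h3 : n.factorial = n * (n - 1).factorial := (Nat.mul_factorial_pred hn.ne').symm
    exact (Nat.eq_of_mul_eq_mul_left hn (h3.symm.trans h2)).symm
  have hamgm := Real.geom_mean_le_arith_mean_weighted (Finset.univ : Finset (Equiv.Perm (Fin n)))
    (fun _ => (n.factorial : ℝ)⁻¹) (fun σ => ∏ r, d (σ r) r) (fun _ _ => by positivity)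
    (by simp [Fintype.card_perm, hfac.ne']) (fun σ _ => Finset.prod_nonneg fun r _ => hd _ _)
  rw [← Finset.mul_sum] at hamgm
  have hprod : ∏ σ : Equiv.Perm (Fin n), (∏ r, d (σ r) r) ^ ((n.factorial : ℝ)⁻¹) =
      ∏ i, (∏ r, d i r) ^ ((n : ℝ)⁻¹) := by
    have e1 : ∏ σ : Equiv.Perm (Fin n), (∏ r, d (σ r) r) =
        (∏ i, ∏ r, d i r) ^ (n - 1).factorial := by
      rw [Finset.prod_comm]
      have : ∀ r : Fin n, ∏ σ : Equiv.Perm (Fin n), d (σ r) r =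
          (∏ i, d i r) ^ (n - 1).factorial := by
        intro r
        rw [← Finset.prod_fiberwise (s := Finset.univ) (g := fun σ : Equiv.Perm (Fin n) => σ r),
          ← Finset.prod_pow]
        refine Finset.prod_congr rfl fun i _ => ?_
        rw [← hcard i r, ← Finset.prod_const]
        refine Finset.prod_congr rfl fun σ hσ => ?_
        rw [(Finset.mem_filter.mp hσ).2]
      simp_rw [this]
      rw [Finset.prod_pow, Finset.prod_comm]
    rw [Real.finsetProd_rpow _ _ (fun σ _ => Finset.prod_nonneg fun r _ => hd _ _), e1,
      Real.finsetProd_rpow _ _ (fun σ _ => Finset.prod_nonneg fun r _ => hd _ _),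
      ← Real.rpow_natCast, ← Real.rpow_mul (Finset.prod_nonneg fun i _ =>
        Finset.prod_nonneg fun r _ => hd _ _)]
    congr 1
    have h3 : (n.factorial : ℝ) = n * (n - 1).factorial := by
      exact_mod_cast (Nat.mul_factorial_pred hn.ne').symm
    have h4 : ((n - 1).factorial : ℝ) ≠ 0 := by exact_mod_cast (n - 1).factorial_ne_zero
    rw [h3]
    field_simp
  rw [hprod] at hamgm
  calc (n.factorial : ℝ) * ∏ i, (∏ r, d i r) ^ ((n : ℝ)⁻¹)
      ≤ n.factorial * ((n.factorial : ℝ)⁻¹ * ∑ σ : Equiv.Perm (Fin n), ∏ r, d (σ r) r) := by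
        gcongr
    _ = _ := by field_simp

/-- The support function of a set in `ℝⁿ`. -/
noncomputable def suppFn {n : ℕ} (K : Set (Fin n → ℝ)) (x : Fin n → ℝ) : ℝ :=
  sSup ((fun y => x ⬝ᵥ y) '' K)

theorem continuous_dotProduct_right {n : ℕ} (x : Fin n → ℝ) :
    Continuous fun y : Fin n → ℝ => x ⬝ᵥ y := by
  unfold dotProduct; fun_prop

theorem abs_dotProduct_le {n : ℕ} (x y : Fin n → ℝ) : |x ⬝ᵥ y| ≤ n * ‖x‖ * ‖y‖ := by
  unfold dotProduct
  calc |∑ i, x i * y i| ≤ ∑ i, |x i * y i| := Finset.abs_sum_le_sum_abs _ _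
    _ ≤ ∑ _i : Fin n, ‖x‖ * ‖y‖ := by
        refine Finset.sum_le_sum fun i _ => ?_
        rw [abs_mul]
        exact mul_le_mul (norm_le_pi_norm x i) (norm_le_pi_norm y i) (abs_nonneg _) (norm_nonneg _)
    _ = _ := by simp [mul_assoc]

theorem sq_norm_le_dotProduct_self {n : ℕ} (x : Fin n → ℝ) : ‖x‖ ^ 2 ≤ x ⬝ᵥ x := by
  have h0 : 0 ≤ x ⬝ᵥ x := Finset.sum_nonneg fun i _ => mul_self_nonneg _
  have h : ‖x‖ ≤ √(x ⬝ᵥ x) := by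
    refine (pi_norm_le_iff_of_nonneg (Real.sqrt_nonneg _)).mpr fun i => ?_
    rw [Real.norm_eq_abs]
    refine Real.abs_le_sqrt ?_
    rw [sq]
    exact Finset.single_le_sum (f := fun i => x i * x i) (fun i _ => mul_self_nonneg _)
      (Finset.mem_univ i)
  calc ‖x‖ ^ 2 ≤ √(x ⬝ᵥ x) ^ 2 := by gcongr
    _ = _ := Real.sq_sqrt h0

section SuppFn

variable {n : ℕ} {K : Set (Fin n → ℝ)}

theorem exists_suppFn_eq (hK : IsCompact K) (hne : K.Nonempty) (x : Fin n → ℝ) :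
    ∃ y ∈ K, suppFn K x = x ⬝ᵥ y := by
  have h := (hK.image (continuous_dotProduct_right x)).sSup_mem (hne.image _)
  obtain ⟨y, hy, h⟩ := h
  exact ⟨y, hy, h.symm⟩

theorem dotProduct_le_suppFn (hK : IsCompact K) (x : Fin n → ℝ) {y : Fin n → ℝ} (hy : y ∈ K) :
    x ⬝ᵥ y ≤ suppFn K x :=
  le_csSup (hK.image (continuous_dotProduct_right x)).bddAbove ⟨y, hy, rfl⟩

theorem suppFn_le (hK : IsCompact K) (hne : K.Nonempty) {x : Fin n → ℝ} {c : ℝ}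
    (h : ∀ y ∈ K, x ⬝ᵥ y ≤ c) : suppFn K x ≤ c := by
  obtain ⟨y, hy, he⟩ := exists_suppFn_eq hK hne x
  exact he ▸ h y hy

theorem suppFn_mono {Q : Set (Fin n → ℝ)} (hK : IsCompact K) (hQ : IsCompact Q) (hne : Q.Nonempty)
    (h : Q ⊆ K) (x : Fin n → ℝ) : suppFn Q x ≤ suppFn K x :=
  suppFn_le hQ hne fun _ hy => dotProduct_le_suppFn hK x (h hy)

theorem suppFn_add_le (hK : IsCompact K) (hne : K.Nonempty) (x v : Fin n → ℝ) :
    suppFn K (x + v) ≤ suppFn K x + suppFn K v :=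
  suppFn_le hK hne fun y hy => by
    rw [add_dotProduct]
    exact add_le_add (dotProduct_le_suppFn hK x hy) (dotProduct_le_suppFn hK v hy)

theorem suppFn_smul (hK : IsCompact K) (hne : K.Nonempty) {t : ℝ} (ht : 0 ≤ t) (x : Fin n → ℝ) :
    suppFn K (t • x) = t * suppFn K x := by
  apply le_antisymm
  · refine suppFn_le hK hne fun y hy => ?_
    rw [smul_dotProduct, smul_eq_mul]
    exact mul_le_mul_of_nonneg_left (dotProduct_le_suppFn hK x hy) ht
  · obtain ⟨y, hy, h⟩ := exists_suppFn_eq hK hne x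
    rw [h, ← smul_eq_mul, ← smul_dotProduct]
    exact dotProduct_le_suppFn hK _ hy

theorem convexOn_suppFn (hK : IsCompact K) (hne : K.Nonempty) :
    ConvexOn ℝ Set.univ (suppFn K) := by
  refine ⟨convex_univ, fun x _ y _ a b ha hb _ => ?_⟩
  calc suppFn K (a • x + b • y) ≤ suppFn K (a • x) + suppFn K (b • y) := suppFn_add_le hK hne _ _
    _ = _ := by rw [suppFn_smul hK hne ha, suppFn_smul hK hne hb]; rfl

theorem exists_abs_suppFn_le (hK : IsCompact K) (hne : K.Nonempty) :
    ∃ L : ℝ, 0 ≤ L ∧ ∀ x, |suppFn K x| ≤ L * ‖x‖ := by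
  obtain ⟨R, hR⟩ := hK.isBounded.exists_norm_le
  have hR0 : 0 ≤ R := (norm_nonneg _).trans (hR _ hne.some_mem)
  refine ⟨n * R, by positivity, fun x => ?_⟩
  obtain ⟨y, hy, h⟩ := exists_suppFn_eq hK hne x
  rw [h]
  calc _ ≤ n * ‖x‖ * ‖y‖ := abs_dotProduct_le x y
    _ ≤ n * ‖x‖ * R := by gcongr; exact hR y hy
    _ = _ := by ring

theorem suppFn_add_set {L : Set (Fin n → ℝ)} (hK : IsCompact K) (hne : K.Nonempty)
    (hL : IsCompact L) (hneL : L.Nonempty) (x : Fin n → ℝ) :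
    suppFn (K + L) x = suppFn K x + suppFn L x := by
  apply le_antisymm
  · refine suppFn_le (hK.add hL) (hne.add hneL) ?_
    rintro _ ⟨y, hy, z, hz, rfl⟩
    simp only [dotProduct_add]
    exact add_le_add (dotProduct_le_suppFn hK x hy) (dotProduct_le_suppFn hL x hz)
  · obtain ⟨y, hy, h⟩ := exists_suppFn_eq hK hne x
    obtain ⟨z, hz, h'⟩ := exists_suppFn_eq hL hneL x
    rw [h, h', ← dotProduct_add]
    exact dotProduct_le_suppFn (hK.add hL) _ (Set.add_mem_add hy hz)

end SuppFn

theorem isCompact_finset_sum {ι E : Type*} [AddCommMonoid E] [TopologicalSpace E] [ContinuousAdd E]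
    {K : ι → Set E} (S : Finset ι) (hK : ∀ i, IsCompact (K i)) : IsCompact (∑ i ∈ S, K i) := by
  classical
  induction S using Finset.induction_on with
  | empty => exact isCompact_singleton
  | insert i S hi ih => rw [Finset.sum_insert hi]; exact (hK i).add ih

theorem nonempty_finset_sum {ι E : Type*} [AddCommMonoid E]
    {K : ι → Set E} (S : Finset ι) (hK : ∀ i, (K i).Nonempty) : (∑ i ∈ S, K i).Nonempty := by
  classical
  induction S using Finset.induction_on with
  | empty => simp
  | insert i S hi ih => rw [Finset.sum_insert hi]; exact (hK i).add ih

theorem convex_finset_sum {ι E : Type*} [AddCommGroup E] [Module ℝ E]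
    {K : ι → Set E} (S : Finset ι) (hK : ∀ i, Convex ℝ (K i)) : Convex ℝ (∑ i ∈ S, K i) := by
  classical
  induction S using Finset.induction_on with
  | empty => exact convex_singleton (𝕜 := ℝ) (0 : E)
  | insert i S hi ih => rw [Finset.sum_insert hi]; exact (hK i).add ih

theorem suppFn_finset_sum {ι : Type*} {n : ℕ} {K : ι → Set (Fin n → ℝ)} (S : Finset ι)
    (hK : ∀ i, IsCompact (K i)) (hne : ∀ i, (K i).Nonempty) (x : Fin n → ℝ) :
    suppFn (∑ i ∈ S, K i) x = ∑ i ∈ S, suppFn (K i) x := by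
  classical
  induction S using Finset.induction_on with
  | empty => simp [suppFn]
  | insert i S hi ih =>
    rw [Finset.sum_insert hi, Finset.sum_insert hi, suppFn_add_set (hK i) (hne i)
      (isCompact_finset_sum S hK) (nonempty_finset_sum S hne), ih]

/-- A convex function whose gradients lie in `K` and which stays within bounded distance
of the support function of `K`. -/
structure IsPot {n : ℕ} (K : Set (Fin n → ℝ)) (φ : (Fin n → ℝ) → ℝ) : Prop where
  convex : ConvexOn ℝ Set.univ φ
  upper : ∀ x v, φ (x + v) ≤ φ x + suppFn K v
  lower : ∃ C, ∀ x, suppFn K x - C ≤ φ x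

section IsPot

variable {n : ℕ} {K : Set (Fin n → ℝ)}

theorem isPot_suppFn (hK : IsCompact K) (hne : K.Nonempty) : IsPot K (suppFn K) :=
  ⟨convexOn_suppFn hK hne, suppFn_add_le hK hne, 0, fun x => by simp⟩

theorem IsPot.continuous {φ : (Fin n → ℝ) → ℝ} (h : IsPot K φ) (hK : IsCompact K)
    (hne : K.Nonempty) : Continuous φ := by
  obtain ⟨L, hL, hb⟩ := exists_abs_suppFn_le hK hne
  refine (LipschitzWith.of_le_add_mul L.toNNReal fun x y => ?_).continuous
  have h1 := h.upper y (x - y)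
  rw [add_sub_cancel] at h1
  rw [Real.coe_toNNReal L hL, dist_eq_norm]
  linarith [le_abs_self (suppFn K (x - y)), hb (x - y)]

theorem IsPot.finset_sum {ι : Type*} {K : ι → Set (Fin n → ℝ)} {φ : ι → (Fin n → ℝ) → ℝ}
    (S : Finset ι) (hK : ∀ i, IsCompact (K i)) (hne : ∀ i, (K i).Nonempty)
    (h : ∀ i, IsPot (K i) (φ i)) : IsPot (∑ i ∈ S, K i) (fun x => ∑ i ∈ S, φ i x) := by
  refine ⟨?_, fun x v => ?_, ?_⟩
  · refine ⟨convex_univ, fun x _ y _ a b ha hb hab => ?_⟩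
    rw [Finset.smul_sum, Finset.smul_sum, ← Finset.sum_add_distrib]
    exact Finset.sum_le_sum fun i _ => (h i).convex.2 trivial trivial ha hb hab
  · rw [suppFn_finset_sum S hK hne, ← Finset.sum_add_distrib]
    exact Finset.sum_le_sum fun i _ => (h i).upper x v
  · choose C hC using fun i => (h i).lower
    refine ⟨∑ i ∈ S, C i, fun x => ?_⟩
    rw [suppFn_finset_sum S hK hne, ← Finset.sum_sub_distrib]
    exact Finset.sum_le_sum fun i _ => hC i x

end IsPot

/-- The gradient of a function on `ℝⁿ`, as a vector of partial derivatives. -/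
noncomputable def gradVec {n : ℕ} (φ : (Fin n → ℝ) → ℝ) (x : Fin n → ℝ) : Fin n → ℝ :=
  fun i => fderiv ℝ φ x (Pi.single i 1)

/-- The Hessian matrix of a function on `ℝⁿ`. -/
noncomputable def hessMat {n : ℕ} (φ : (Fin n → ℝ) → ℝ) (x : Fin n → ℝ) :
    Matrix (Fin n) (Fin n) ℝ :=
  Matrix.of fun i j => fderiv ℝ (fderiv ℝ φ) x (Pi.single j 1) (Pi.single i 1)

section Hessian

variable {n : ℕ} {φ : (Fin n → ℝ) → ℝ}

theorem eq_sum_smul_single (v : Fin n → ℝ) : v = ∑ i, v i • (Pi.single i 1 : Fin n → ℝ) := by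
  ext j
  simp [Finset.sum_apply, Pi.single_apply]

theorem fderiv_eq_dotProduct_gradVec (x v : Fin n → ℝ) :
    fderiv ℝ φ x v = v ⬝ᵥ gradVec φ x := by
  conv_lhs => rw [eq_sum_smul_single v]
  simp [dotProduct, gradVec]

theorem hessMat_mulVec (x v : Fin n → ℝ) (i : Fin n) :
    (hessMat φ x).mulVec v i = fderiv ℝ (fderiv ℝ φ) x v (Pi.single i 1) := by
  conv_rhs => rw [eq_sum_smul_single v]
  simp [Matrix.mulVec, dotProduct, hessMat, mul_comm]

theorem dotProduct_hessMat_mulVec (x v w : Fin n → ℝ) :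
    w ⬝ᵥ (hessMat φ x).mulVec v = fderiv ℝ (fderiv ℝ φ) x v w := by
  conv_rhs => rw [eq_sum_smul_single w]
  simp [dotProduct, hessMat_mulVec]

theorem hasFDerivAt_gradVec (hφ : ContDiff ℝ 2 φ) (x : Fin n → ℝ) :
    HasFDerivAt (gradVec φ) (Matrix.toLin' (hessMat φ x)).toContinuousLinearMap x := by
  rw [hasFDerivAt_pi']
  intro i
  have h1 : DifferentiableAt ℝ (fderiv ℝ φ) x :=
    ((hφ.fderiv_right (m := 1) (by norm_num)).differentiable one_ne_zero) x
  have h2 := h1.hasFDerivAt.clm_apply (hasFDerivAt_const (Pi.single i 1 : Fin n → ℝ) x)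
  refine h2.congr_fderiv ?_
  ext v
  simp [hessMat_mulVec, ContinuousLinearMap.comp_apply]

theorem hessMat_congr {ψ : (Fin n → ℝ) → ℝ} {x : Fin n → ℝ} (h : φ =ᶠ[𝓝 x] ψ) :
    hessMat φ x = hessMat ψ x := by
  unfold hessMat
  rw [h.fderiv.fderiv_eq]

theorem hessMat_comp_sub (a x : Fin n → ℝ) :
    hessMat (fun y => φ (y - a)) x = hessMat φ (x - a) := by
  have h : fderiv ℝ (fun y => φ (y - a)) = fun y => fderiv ℝ φ (y - a) := by
    ext1 y; exact fderiv_comp_sub a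
  unfold hessMat
  rw [h, fderiv_comp_sub]

theorem hessMat_add_const (c : ℝ) (x : Fin n → ℝ) :
    hessMat (fun y => φ y + c) x = hessMat φ x := by
  unfold hessMat
  have h : fderiv ℝ (fun y => φ y + c) = fderiv ℝ φ := by
    ext1 y; exact fderiv_add_const c
  rw [h]

theorem hessMat_sum {ι : Type*} {φ : ι → (Fin n → ℝ) → ℝ} (S : Finset ι)
    (hφ : ∀ i, ContDiff ℝ 2 (φ i)) (x : Fin n → ℝ) :
    hessMat (fun y => ∑ i ∈ S, φ i y) x = ∑ i ∈ S, hessMat (φ i) x := by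
  have h : fderiv ℝ (fun y => ∑ i ∈ S, φ i y) = fun y => ∑ i ∈ S, fderiv ℝ (φ i) y := by
    ext1 y
    exact fderiv_fun_sum fun i _ => ((hφ i).differentiable two_ne_zero) y
  ext r c
  simp only [hessMat, Matrix.of_apply, Matrix.sum_apply]
  rw [h, fderiv_fun_sum fun i _ =>
    (((hφ i).fderiv_right (m := 1) (by norm_num)).differentiable one_ne_zero) x]
  simp

theorem continuous_hessMat (hφ : ContDiff ℝ 2 φ) : Continuous (hessMat φ) := by
  have h : Continuous (fderiv ℝ (fderiv ℝ φ)) :=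
    (hφ.fderiv_right (m := 1) (by norm_num)).continuous_fderiv one_ne_zero
  refine continuous_matrix fun i j => ?_
  exact (h.clm_apply continuous_const).clm_apply continuous_const

theorem hasDerivAt_line (hφ : ContDiff ℝ 2 φ) (x v : Fin n → ℝ) (t : ℝ) :
    HasDerivAt (fun t : ℝ => φ (x + t • v)) (fderiv ℝ φ (x + t • v) v) t := by
  have h1 : HasDerivAt (fun t : ℝ => x + t • v) v t := by
    simpa using ((hasDerivAt_id t).smul_const v).const_add x
  exact ((hφ.differentiable two_ne_zero _).hasFDerivAt).comp_hasDerivAt t h1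

theorem convexOn_line (hc : ConvexOn ℝ Set.univ φ) (x v : Fin n → ℝ) :
    ConvexOn ℝ Set.univ (fun t : ℝ => φ (x + t • v)) := by
  have := hc.comp_affineMap (AffineMap.lineMap x (x + v) : ℝ →ᵃ[ℝ] (Fin n → ℝ))
  refine this.congr fun t _ => ?_
  simp [AffineMap.lineMap_apply, add_comm]

theorem add_fderiv_le (hc : ConvexOn ℝ Set.univ φ) (hφ : ContDiff ℝ 2 φ) (x v : Fin n → ℝ) :
    φ x + fderiv ℝ φ x v ≤ φ (x + v) := by
  have h1 := (hasDerivAt_line hφ x v 0).hasDerivWithinAt (s := Set.Ioi 0)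
  have := (convexOn_line hc x v).le_slope_of_hasDerivWithinAt_Ioi (Set.mem_univ 0)
    (Set.mem_univ 1) one_pos h1
  simp [slope_def_field] at this
  linarith

theorem hessMat_posSemidef (hc : ConvexOn ℝ Set.univ φ) (hφ : ContDiff ℝ 2 φ) (x : Fin n → ℝ) :
    (hessMat φ x).PosSemidef := by
  refine Matrix.PosSemidef.of_dotProduct_mulVec_nonneg ?_ fun v => ?_
  · ext i j
    have h := (hφ.contDiffAt (x := x)).isSymmSndFDerivAt
      (by rw [minSmoothness_of_isRCLikeNormedField])
    simp only [Matrix.conjTranspose_apply, hessMat, Matrix.of_apply, star_trivial]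
    exact h _ _
  · rw [star_trivial, dotProduct_hessMat_mulVec]
    have hmono : Monotone (fun t : ℝ => fderiv ℝ φ (x + t • v) v) := by
      intro s t hst
      have h1 := add_fderiv_le hc hφ (x + s • v) ((t - s) • v)
      have h2 := add_fderiv_le hc hφ (x + t • v) ((s - t) • v)
      have e1 : x + s • v + (t - s) • v = x + t • v := by module
      have e2 : x + t • v + (s - t) • v = x + s • v := by module
      rw [e1] at h1
      rw [e2] at h2
      simp only [map_smul, smul_eq_mul] at h1 h2
      rcases hst.eq_or_lt with rfl | hlt
      · exact le_rfl
      · have : 0 < t - s := sub_pos.mpr hlt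
        show fderiv ℝ φ (x + s • v) v ≤ fderiv ℝ φ (x + t • v) v
        by_contra! hcon
        nlinarith
    have hd : HasDerivAt (fun t : ℝ => fderiv ℝ φ (x + t • v) v)
        (fderiv ℝ (fderiv ℝ φ) x v v) 0 := by
      have h1 : HasDerivAt (fun t : ℝ => x + t • v) v 0 := by
        simpa using ((hasDerivAt_id (0 : ℝ)).smul_const v).const_add x
      have h2 : HasFDerivAt (fderiv ℝ φ) (fderiv ℝ (fderiv ℝ φ) x) (x + (0 : ℝ) • v) := by
        simpa using (((hφ.fderiv_right (m := 1) (by norm_num)).differentiable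
          one_ne_zero) x).hasFDerivAt
      have h3 := h2.comp_hasDerivAt 0 h1
      simpa using h3.clm_apply (hasDerivAt_const (0 : ℝ) v)
    rw [← hd.deriv]
    exact hmono.deriv_nonneg

theorem injOn_gradVec (hc : ConvexOn ℝ Set.univ φ) (hφ : ContDiff ℝ 2 φ) :
    Set.InjOn (gradVec φ) {x | (hessMat φ x).det ≠ 0} := by
  intro x hx y _ hxy
  by_contra hne
  set v := y - x with hv
  have hv0 : v ≠ 0 := sub_ne_zero.mpr (Ne.symm hne)
  have hgrad : ∀ t ∈ Set.Icc (0 : ℝ) 1, gradVec φ (x + t • v) = gradVec φ x := by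
    intro t ht
    have hmin : ∀ w, φ x - x ⬝ᵥ gradVec φ x ≤ φ w - w ⬝ᵥ gradVec φ x := by
      intro w
      have := add_fderiv_le hc hφ x (w - x)
      rw [fderiv_eq_dotProduct_gradVec, sub_dotProduct, add_sub_cancel] at this
      linarith
    have hminy : φ y - y ⬝ᵥ gradVec φ x ≤ φ x - x ⬝ᵥ gradVec φ x := by
      have := add_fderiv_le hc hφ y (x - y)
      rw [fderiv_eq_dotProduct_gradVec, sub_dotProduct, add_sub_cancel, ← hxy] at this
      linarith
    have ht' : φ (x + t • v) - (x + t • v) ⬝ᵥ gradVec φ x ≤ φ x - x ⬝ᵥ gradVec φ x := by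
      have h1 := hc.2 (Set.mem_univ x) (Set.mem_univ y) (sub_nonneg.mpr ht.2) ht.1 (by ring)
      have e : (1 - t) • x + t • y = x + t • v := by rw [hv]; module
      rw [e] at h1
      simp only [smul_eq_mul] at h1
      have e2 : (x + t • v) ⬝ᵥ gradVec φ x =
          (1 - t) * (x ⬝ᵥ gradVec φ x) + t * (y ⬝ᵥ gradVec φ x) := by
        rw [← e, add_dotProduct, smul_dotProduct, smul_dotProduct, smul_eq_mul, smul_eq_mul]
      rw [e2]
      nlinarith [ht.1, ht.2]
    funext i
    have hloc : IsLocalMin (fun w => φ w - w ⬝ᵥ gradVec φ x) (x + t • v) :=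
      Eventually.of_forall fun w => ht'.trans (hmin w)
    have hdot : HasFDerivAt (fun w : Fin n → ℝ => w ⬝ᵥ gradVec φ x) (fderiv ℝ φ x)
        (x + t • v) := by
      have : (fun w : Fin n → ℝ => w ⬝ᵥ gradVec φ x) = fun w => fderiv ℝ φ x w :=
        funext fun w => (fderiv_eq_dotProduct_gradVec x w).symm
      rw [this]
      exact (fderiv ℝ φ x).hasFDerivAt
    have h0 := hloc.hasFDerivAt_eq_zero
      (((hφ.differentiable two_ne_zero (x + t • v)).hasFDerivAt).sub hdot)
    rw [sub_eq_zero] at h0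
    simp only [gradVec, h0]
  have h1 : HasDerivAt (fun t : ℝ => x + t • v) v 0 := by
    simpa using ((hasDerivAt_id (0 : ℝ)).smul_const v).const_add x
  have h2 : HasFDerivAt (gradVec φ) (Matrix.toLin' (hessMat φ x)).toContinuousLinearMap
      (x + (0 : ℝ) • v) := by simpa using hasFDerivAt_gradVec hφ x
  have h3 := (h2.comp_hasDerivAt 0 h1).hasDerivWithinAt (s := Set.Icc 0 1)
  have h4 : HasDerivWithinAt (gradVec φ ∘ fun t : ℝ => x + t • v) 0 (Set.Icc 0 1) 0 :=
    (hasDerivWithinAt_const (0 : ℝ) (Set.Icc 0 1) (gradVec φ x)).congr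
      (fun t ht => hgrad t ht) (hgrad 0 (by simp))
  have h5 := (uniqueDiffOn_Icc (zero_lt_one' ℝ) 0 (by simp)).eq_deriv _ h3 h4
  exact hx (Matrix.exists_mulVec_eq_zero_iff.mp ⟨v, hv0, by simpa using h5⟩)

end Hessian

section Representation

variable {n : ℕ} {K : Set (Fin n → ℝ)} {φ : (Fin n → ℝ) → ℝ}

theorem IsPot.gradVec_mem (h : IsPot K φ) (hφ : ContDiff ℝ 2 φ) (hK : IsCompact K)
    (hne : K.Nonempty) (hconv : Convex ℝ K) (x : Fin n → ℝ) : gradVec φ x ∈ K := by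
  by_contra hx
  obtain ⟨f, u, hfu, huf⟩ := geometric_hahn_banach_closed_point hconv hK.isClosed hx
  set v : Fin n → ℝ := fun i => f (Pi.single i 1) with hv
  have hf : ∀ y, f y = v ⬝ᵥ y := by
    intro y
    conv_lhs => rw [eq_sum_smul_single y]
    simp [dotProduct, hv, mul_comm]
  have h1 := add_fderiv_le h.convex hφ x v
  rw [fderiv_eq_dotProduct_gradVec, ← hf] at h1
  obtain ⟨y, hy, he⟩ := exists_suppFn_eq hK hne v
  have h2 := h.upper x v
  rw [he, ← hf] at h2
  linarith [hfu y hy]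

theorem IsPot.interior_subset_range (h : IsPot K φ) (hφ : ContDiff ℝ 2 φ) (hK : IsCompact K) :
    interior K ⊆ Set.range (gradVec φ) := by
  intro p hp
  obtain ⟨r, hr, hball⟩ := Metric.nhds_basis_closedBall.mem_iff.mp (mem_interior_iff_mem_nhds.mp hp)
  obtain ⟨C, hC⟩ := h.lower
  have hlow : ∀ x, r * ‖x‖ - C ≤ φ x - x ⬝ᵥ p := by
    intro x
    rcases eq_or_ne x 0 with rfl | hx
    · have h1 := hC 0
      have h2 := dotProduct_le_suppFn hK 0 (interior_subset hp)
      simp at h2 ⊢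
      linarith
    · have hx' : 0 < ‖x‖ := norm_pos_iff.mpr hx
      have hmem : p + (r / ‖x‖) • x ∈ K := by
        apply hball
        rw [mem_closedBall_iff_norm, add_sub_cancel_left, norm_smul, Real.norm_eq_abs,
          abs_of_nonneg (by positivity), div_mul_cancel₀ _ hx'.ne']
      have h1 := dotProduct_le_suppFn hK x hmem
      rw [dotProduct_add, dotProduct_smul, smul_eq_mul] at h1
      have h2 : r * ‖x‖ ≤ r / ‖x‖ * (x ⬝ᵥ x) := by
        calc r * ‖x‖ = r / ‖x‖ * ‖x‖ ^ 2 := by field_simp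
          _ ≤ _ := by gcongr; exact sq_norm_le_dotProduct_self x
      linarith [hC x]
  have hdot : ∀ w : Fin n → ℝ, HasFDerivAt (fun w : Fin n → ℝ => w ⬝ᵥ p)
      (LinearMap.toContinuousLinearMap ((dotProductBilin ℝ ℝ).flip p)) w := fun w =>
    (LinearMap.toContinuousLinearMap ((dotProductBilin ℝ ℝ).flip p) :
      (Fin n → ℝ) →L[ℝ] ℝ).hasFDerivAt
  have hcont : Continuous fun x => φ x - x ⬝ᵥ p :=
    hφ.continuous.sub (continuous_iff_continuousAt.mpr fun w => (hdot w).continuousAt)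
  have htend : Tendsto (fun x => φ x - x ⬝ᵥ p) (cocompact _) atTop := by
    refine tendsto_atTop_mono hlow ?_
    exact tendsto_atTop_add_const_right _ _ ((tendsto_norm_cocompact_atTop).const_mul_atTop hr)
  obtain ⟨x, hx⟩ := hcont.exists_forall_le htend
  refine ⟨x, ?_⟩
  have hloc : IsLocalMin (fun w => φ w - w ⬝ᵥ p) x := Eventually.of_forall hx
  have h0 := hloc.hasFDerivAt_eq_zero
    (((hφ.differentiable two_ne_zero x).hasFDerivAt).sub (hdot x))
  rw [sub_eq_zero] at h0
  funext i
  simp [gradVec, h0]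

theorem IsPot.lintegral_det_hessMat (h : IsPot K φ) (hφ : ContDiff ℝ 2 φ) (hK : IsCompact K)
    (hne : K.Nonempty) (hconv : Convex ℝ K) :
    ∫⁻ x, ENNReal.ofReal (hessMat φ x).det = volume K := by
  have hpos : ∀ x, 0 ≤ (hessMat φ x).det := fun x => (hessMat_posSemidef h.convex hφ x).det_nonneg
  have hcontdet : Continuous fun x => (hessMat φ x).det := (continuous_hessMat hφ).matrix_det
  set G := {x | (hessMat φ x).det ≠ 0} with hG
  have hGm : MeasurableSet G := (isOpen_ne_fun hcontdet continuous_const).measurableSet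
  have hderiv : ∀ x (s : Set (Fin n → ℝ)), HasFDerivWithinAt (gradVec φ)
      (Matrix.toLin' (hessMat φ x)).toContinuousLinearMap s x :=
    fun x s => (hasFDerivAt_gradVec hφ x).hasFDerivWithinAt
  have hdet : ∀ x, ((Matrix.toLin' (hessMat φ x)).toContinuousLinearMap).det =
      (hessMat φ x).det := fun x => by
    rw [ContinuousLinearMap.det, LinearMap.coe_toContinuousLinearMap, LinearMap.det_toLin']
  have h1 := lintegral_abs_det_fderiv_eq_addHaar_image volume hGm (fun x _ => hderiv x G)
    (injOn_gradVec h.convex hφ)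
  simp_rw [hdet, abs_of_nonneg (hpos _)] at h1
  have h2 : volume (gradVec φ '' Gᶜ) = 0 :=
    addHaar_image_eq_zero_of_det_fderivWithin_eq_zero volume (fun x _ => hderiv x Gᶜ)
      (fun x hx => by rw [hdet]; simpa [hG] using hx)
  have h3 : ∫⁻ x, ENNReal.ofReal (hessMat φ x).det =
      ∫⁻ x in G, ENNReal.ofReal (hessMat φ x).det := by
    rw [← lintegral_add_compl _ hGm, setLIntegral_congr_fun (g := fun _ => 0) hGm.compl]
    · simp
    · intro x hx
      have : (hessMat φ x).det = 0 := by simpa [hG] using hx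
      simp [this]
  rw [h3, h1]
  apply le_antisymm
  · refine measure_mono ?_
    rintro _ ⟨x, _, rfl⟩
    exact h.gradVec_mem hφ hK hne hconv x
  · have h4 : volume K ≤ volume (interior K) + volume (frontier K) := by
      refine (measure_mono ?_).trans (measure_union_le _ _)
      rw [← closure_eq_interior_union_frontier]
      exact subset_closure
    rw [hconv.addHaar_frontier volume, add_zero] at h4
    refine h4.trans ((measure_mono (h.interior_subset_range hφ hK)).trans ?_)
    rw [← Set.image_univ, ← Set.union_compl_self G, Set.image_union]
    refine (measure_union_le _ _).trans ?_
    rw [h2, add_zero]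

end Representation

/-- A smooth bump function supported in the unit ball of `ℝⁿ`. -/
noncomputable def unitBump (n : ℕ) : ContDiffBump (0 : Fin n → ℝ) :=
  ⟨1 / 2, 1, by norm_num, by norm_num⟩

/-- The mollification of a function at unit scale. -/
noncomputable def moll {n : ℕ} (φ : (Fin n → ℝ) → ℝ) (x : Fin n → ℝ) : ℝ :=
  ∫ z, (unitBump n).normed volume z * φ (x - z)

section Moll

variable {n : ℕ} {φ ψ : (Fin n → ℝ) → ℝ}

theorem integrable_unitBump_mul {g : (Fin n → ℝ) → ℝ} (hg : Continuous g) :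
    Integrable fun z => (unitBump n).normed volume z * g z :=
  ((unitBump n).continuous_normed.mul hg).integrable_of_hasCompactSupport
    (unitBump n).hasCompactSupport_normed.mul_right

theorem integral_unitBump_mul_le {g h : (Fin n → ℝ) → ℝ} (hg : Continuous g) (hh : Continuous h)
    (hgh : ∀ z, ‖z‖ < 1 → g z ≤ h z) :
    ∫ z, (unitBump n).normed volume z * g z ≤ ∫ z, (unitBump n).normed volume z * h z := by
  refine integral_mono (integrable_unitBump_mul hg) (integrable_unitBump_mul hh) fun z => ?_
  by_cases hz : ‖z‖ < 1
  · exact mul_le_mul_of_nonneg_left (hgh z hz) ((unitBump n).nonneg_normed z)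
  · have : (unitBump n).normed volume z = 0 := by
      rw [← Function.notMem_support, (unitBump n).support_normed_eq]
      simpa [unitBump] using hz
    simp [this]

theorem integral_unitBump_mul_const (c : ℝ) :
    ∫ z, (unitBump n).normed volume z * c = c := by
  rw [integral_mul_const, (unitBump n).integral_normed, one_mul]

theorem moll_eq_of_eq_on {x y : Fin n → ℝ} {c : ℝ} (hψ : Continuous ψ)
    (h : ∀ z, ‖z‖ < 1 → φ (x - z) = ψ (y - z) + c) : moll φ x = moll ψ y + c := by
  have hc : Continuous fun z => ψ (y - z) := hψ.comp (continuous_const.sub continuous_id)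
  conv_rhs => rw [← integral_unitBump_mul_const (n := n) c]
  unfold moll
  rw [← integral_add (integrable_unitBump_mul hc) (integrable_unitBump_mul continuous_const)]
  congr 1
  ext z
  by_cases hz : ‖z‖ < 1
  · rw [h z hz, mul_add]
  · have : (unitBump n).normed volume z = 0 := by
      rw [← Function.notMem_support, (unitBump n).support_normed_eq]
      simpa [unitBump] using hz
    simp [this]

theorem contDiff_moll (hφ : Continuous φ) : ContDiff ℝ 2 (moll φ) := by
  have h := (unitBump n).hasCompactSupport_normed.contDiff_convolution_left (μ := volume)
    (ContinuousLinearMap.lsmul ℝ ℝ) ((unitBump n).contDiff_normed (μ := volume) (n := 2))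
    (hφ.locallyIntegrable (μ := volume))
  exact h

theorem IsPot.moll {K : Set (Fin n → ℝ)} (h : IsPot K φ) (hK : IsCompact K) (hne : K.Nonempty) :
    IsPot K (moll φ) := by
  have hφ := h.continuous hK hne
  have hc : ∀ x, Continuous fun z => φ (x - z) := fun x =>
    hφ.comp (continuous_const.sub continuous_id)
  refine ⟨⟨convex_univ, fun x _ y _ a b ha hb hab => ?_⟩, fun x v => ?_, ?_⟩
  · have h1 := integral_unitBump_mul_le (n := n) (hc (a • x + b • y))
      (((hc x).const_smul a).add ((hc y).const_smul b)) fun z _ => by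
        have := h.convex.2 (Set.mem_univ (x - z)) (Set.mem_univ (y - z)) ha hb hab
        rw [show a • x + b • y - z = a • (x - z) + b • (y - z) by
          rw [smul_sub, smul_sub, sub_add_sub_comm, ← add_smul, hab, one_smul]]
        exact this
    refine h1.trans_eq ?_
    simp only [Pi.add_apply, Pi.smul_apply, smul_eq_mul, mul_add, _root_.moll]
    rw [integral_add]
    · simp only [mul_left_comm _ a, mul_left_comm _ b, integral_const_mul]
    · exact integrable_unitBump_mul ((hc x).const_smul a)
    · exact integrable_unitBump_mul ((hc y).const_smul b)
  · have h1 := integral_unitBump_mul_le (n := n) (hc (x + v)) ((hc x).add_const (suppFn K v))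
      fun z _ => by
        rw [show x + v - z = x - z + v by abel]
        exact h.upper _ _
    refine h1.trans_eq ?_
    simp only [mul_add, _root_.moll]
    rw [integral_add (integrable_unitBump_mul (hc x)) (integrable_unitBump_mul continuous_const),
      integral_unitBump_mul_const]
  · obtain ⟨C, hC⟩ := h.lower
    obtain ⟨L, hL, hb⟩ := exists_abs_suppFn_le hK hne
    refine ⟨C + L, fun x => ?_⟩
    conv_lhs => rw [← integral_unitBump_mul_const (n := n) (suppFn K x - (C + L))]
    refine integral_unitBump_mul_le (n := n) continuous_const (hc x) fun z hz => ?_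
    have h1 := hC (x - z)
    have h2 := suppFn_add_le hK hne (x - z) z
    rw [sub_add_cancel] at h2
    have h3 := (le_abs_self _).trans (hb z)
    have h4 : L * ‖z‖ ≤ L * 1 := by gcongr
    linarith

end Moll

/-- `n!` times the mixed volume of `n` sets in `ℝⁿ`, by polarization. -/
noncomputable def mixedVol {n : ℕ} (K : Fin n → Set (Fin n → ℝ)) : ℝ :=
  altSum fun S => (volume (∑ i ∈ S, K i)).toReal

/-- The mixed discriminant of the Hessians of the mollifications of `φ i` at `x`. -/
noncomputable def mollDisc {n : ℕ} (φ : Fin n → (Fin n → ℝ) → ℝ) (x : Fin n → ℝ) : ℝ :=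
  mixedDisc fun i => hessMat (moll (φ i)) x

section MixedVol

variable {n : ℕ} {K : Fin n → Set (Fin n → ℝ)} {φ : Fin n → (Fin n → ℝ) → ℝ}

theorem mollDisc_nonneg (hK : ∀ i, IsCompact (K i)) (hne : ∀ i, (K i).Nonempty)
    (h : ∀ i, IsPot (K i) (φ i)) (x : Fin n → ℝ) : 0 ≤ mollDisc φ x :=
  mixedDisc_nonneg _ fun i => hessMat_posSemidef ((h i).moll (hK i) (hne i)).convex
    (contDiff_moll ((h i).continuous (hK i) (hne i))) x

theorem integrable_mollDisc (hK : ∀ i, IsCompact (K i)) (hne : ∀ i, (K i).Nonempty)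
    (hconv : ∀ i, Convex ℝ (K i)) (h : ∀ i, IsPot (K i) (φ i)) :
    Integrable (mollDisc φ) ∧ ∫ x, mollDisc φ x = mixedVol K := by
  have hs : ∀ i, ContDiff ℝ 2 (moll (φ i)) := fun i =>
    contDiff_moll ((h i).continuous (hK i) (hne i))
  have hp : ∀ S : Finset (Fin n), IsPot (∑ i ∈ S, K i) (fun x => ∑ i ∈ S, moll (φ i) x) := fun S =>
    IsPot.finset_sum S hK hne fun i => (h i).moll (hK i) (hne i)
  have hsS : ∀ S : Finset (Fin n), ContDiff ℝ 2 fun x => ∑ i ∈ S, moll (φ i) x := fun S =>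
    ContDiff.sum fun i _ => hs i
  have hd : ∀ S : Finset (Fin n), ∀ x,
      0 ≤ (∑ i ∈ S, hessMat (moll (φ i)) x).det := fun S x => by
    rw [← hessMat_sum S hs]
    exact (hessMat_posSemidef (hp S).convex (hsS S) x).det_nonneg
  have hl : ∀ S : Finset (Fin n), ∫⁻ x, ENNReal.ofReal (∑ i ∈ S, hessMat (moll (φ i)) x).det
      = volume (∑ i ∈ S, K i) := fun S => by
    rw [← (hp S).lintegral_det_hessMat (hsS S) (isCompact_finset_sum S hK)
      (nonempty_finset_sum S hne) (convex_finset_sum S hconv)]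
    simp only [hessMat_sum S hs]
  have hcont : ∀ S : Finset (Fin n), Continuous fun x => (∑ i ∈ S, hessMat (moll (φ i)) x).det :=
    fun S => (continuous_finsetSum _ fun i _ => continuous_hessMat (hs i)).matrix_det
  have hdet : ∀ S : Finset (Fin n), Integrable fun x => (∑ i ∈ S, hessMat (moll (φ i)) x).det := by
    intro S
    refine ⟨(hcont S).aestronglyMeasurable, ?_⟩
    rw [hasFiniteIntegral_iff_ofReal (ae_of_all _ (hd S)), hl S]
    exact (isCompact_finset_sum S hK).measure_lt_top
  unfold mollDisc mixedDisc mixedVol altSum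
  refine ⟨integrable_finsetSum _ fun S _ => (hdet S).const_mul _, ?_⟩
  rw [integral_finsetSum _ fun S _ => (hdet S).const_mul _]
  refine Finset.sum_congr rfl fun S _ => ?_
  rw [integral_const_mul, integral_eq_lintegral_of_nonneg_ae (ae_of_all _ (hd S))
    (hcont S).aestronglyMeasurable, hl S]

theorem mixedVol_nonneg (hK : ∀ i, IsCompact (K i)) (hne : ∀ i, (K i).Nonempty)
    (hconv : ∀ i, Convex ℝ (K i)) : 0 ≤ mixedVol K := by
  have h := fun i => isPot_suppFn (hK i) (hne i)
  rw [← (integrable_mollDisc hK hne hconv h).2]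
  exact integral_nonneg (mollDisc_nonneg hK hne h)

theorem tendsto_setIntegral_mollDisc (hK : ∀ i, IsCompact (K i)) (hne : ∀ i, (K i).Nonempty)
    (hconv : ∀ i, Convex ℝ (K i)) (h : ∀ i, IsPot (K i) (φ i)) :
    Tendsto (fun R : ℕ => ∫ x in Metric.ball 0 (R : ℝ), mollDisc φ x) atTop (𝓝 (mixedVol K)) := by
  have h1 := integrable_mollDisc hK hne hconv h
  rw [← h1.2, ← setIntegral_univ, ← Metric.iUnion_ball_nat (0 : Fin n → ℝ)]
  refine tendsto_setIntegral_of_monotone (fun _ => measurableSet_ball) ?_ h1.1.integrableOn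
  exact fun a b hab => Metric.ball_subset_ball (by exact_mod_cast hab)

theorem mollDisc_eq_of_eq_on {ψ : Fin n → (Fin n → ℝ) → ℝ} (hψ : ∀ i, Continuous (ψ i))
    {p : Fin n → ℝ} {R : ℝ} {c : Fin n → ℝ}
    (he : ∀ i, ∀ z, ‖z‖ < R + 1 → φ i (p + z) = ψ i z + c i) {x : Fin n → ℝ} (hx : ‖x‖ < R) :
    mollDisc φ (p + x) = mollDisc ψ x := by
  unfold mollDisc
  congr 1
  ext1 i
  have h1 : moll (φ i) =ᶠ[𝓝 (p + x)] fun y => moll (ψ i) (y - p) + c i := by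
    have : ∀ᶠ y in 𝓝 (p + x), ‖y - p‖ < R := by
      have hc : Continuous fun y => ‖y - p‖ := by fun_prop
      refine (hc.tendsto _).eventually_lt_const ?_
      simpa using hx
    filter_upwards [this] with y hy
    refine moll_eq_of_eq_on (hψ i) fun z hz => ?_
    rw [← he i _ ((norm_sub_le _ _).trans_lt (by linarith))]
    congr 1
    abel
  rw [hessMat_congr h1, hessMat_add_const, hessMat_comp_sub]
  simp

theorem setIntegral_mollDisc_eq {ψ : Fin n → (Fin n → ℝ) → ℝ} (hψ : ∀ i, Continuous (ψ i))
    {p : Fin n → ℝ} {R : ℝ} {c : Fin n → ℝ}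
    (he : ∀ i, ∀ z, ‖z‖ < R + 1 → φ i (p + z) = ψ i z + c i) :
    ∫ x in Metric.ball p R, mollDisc φ x = ∫ x in Metric.ball 0 R, mollDisc ψ x := by
  have h1 := (measurePreserving_add_left volume p).setIntegral_preimage_emb
    (measurableEmbedding_addLeft p) (mollDisc φ) (Metric.ball p R)
  rw [← h1]
  have h2 : (fun x => p + x) ⁻¹' Metric.ball p R = Metric.ball 0 R := by
    ext x; simp [dist_eq_norm]
  rw [h2]
  refine setIntegral_congr_fun measurableSet_ball fun x hx => ?_
  exact mollDisc_eq_of_eq_on hψ he (by simpa using hx)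

end MixedVol

theorem IsPot.max_sub {n : ℕ} {K : Set (Fin n → ℝ)} {ψ : (Fin n → ℝ) → ℝ} {C : ℝ}
    (hK : IsCompact K) (hne : K.Nonempty) (hc : ConvexOn ℝ Set.univ ψ)
    (hu : ∀ x v, ψ (x + v) ≤ ψ x + suppFn K v) :
    IsPot K fun x => max (suppFn K x - C) (ψ x) := by
  refine ⟨?_, fun x v => ?_, C, fun x => le_max_left _ _⟩
  · have h : ConvexOn ℝ Set.univ fun x => suppFn K x - C := by
      simp only [sub_eq_add_neg]
      exact (convexOn_suppFn hK hne).add_const (-C)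
    exact h.sup hc
  · have := suppFn_add_le hK hne x v
    have := hu x v
    rw [max_le_iff]
    constructor
    · linarith [le_max_left (suppFn K x - C) (ψ x)]
    · linarith [le_max_right (suppFn K x - C) (ψ x)]

section Superadditivity

variable {n : ℕ} {K Q P : Fin n → Set (Fin n → ℝ)}

theorem exists_forall_abs_suppFn_le (hK : ∀ i, IsCompact (K i)) (hne : ∀ i, (K i).Nonempty) :
    ∃ L, 0 ≤ L ∧ ∀ i x, |suppFn (K i) x| ≤ L * ‖x‖ := by
  choose L hL hb using fun i => exists_abs_suppFn_le (hK i) (hne i)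
  refine ⟨∑ i, L i, Finset.sum_nonneg fun i _ => hL i, fun i x => (hb i x).trans ?_⟩
  gcongr
  exact Finset.single_le_sum (f := L) (fun j _ => hL j) (Finset.mem_univ i)

theorem mixedVol_mono (hK : ∀ i, IsCompact (K i)) (hconv : ∀ i, Convex ℝ (K i))
    (hQ : ∀ i, IsCompact (Q i)) (hQne : ∀ i, (Q i).Nonempty) (hQconv : ∀ i, Convex ℝ (Q i))
    (h : ∀ i, Q i ⊆ K i) : mixedVol Q ≤ mixedVol K := by
  have hne : ∀ i, (K i).Nonempty := fun i => (hQne i).mono (h i)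
  obtain ⟨L, hL, hb⟩ := exists_forall_abs_suppFn_le hK hne
  obtain ⟨M, hM, hb'⟩ := exists_forall_abs_suppFn_le hQ hQne
  refine le_of_tendsto' (tendsto_setIntegral_mollDisc hQ hQne hQconv
    fun i => isPot_suppFn (hQ i) (hQne i)) fun R => ?_
  have hp : ∀ i, IsPot (K i)
      fun x => max (suppFn (K i) x - (L + M) * (R + 1)) (suppFn (Q i) x) := fun i =>
    IsPot.max_sub (hK i) (hne i) (convexOn_suppFn (hQ i) (hQne i)) fun x v =>
      (suppFn_add_le (hQ i) (hQne i) x v).trans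
        (by gcongr; exact suppFn_mono (hK i) (hQ i) (hQne i) (h i) v)
  have hi := integrable_mollDisc hK hne hconv hp
  rw [← hi.2, ← setIntegral_mollDisc_eq (p := 0) (c := 0)
    (fun i => (isPot_suppFn (hQ i) (hQne i)).continuous (hQ i) (hQne i)) (fun i z hz => ?_)]
  · exact setIntegral_le_integral hi.1 (ae_of_all _ (mollDisc_nonneg hK hne hp))
  · have h1 := abs_le.1 (hb i z)
    have h2 := abs_le.1 (hb' i z)
    have h3 : (L + M) * ‖z‖ ≤ (L + M) * (R + 1) := by gcongr
    simp only [zero_add, Pi.zero_apply, add_zero]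
    refine max_eq_right ?_
    linarith

theorem mixedVol_add_le_of_lt (hK : ∀ i, IsCompact (K i)) (hconv : ∀ i, Convex ℝ (K i))
    (hQ : ∀ i, IsCompact (Q i)) (hQne : ∀ i, (Q i).Nonempty) (hQconv : ∀ i, Convex ℝ (Q i))
    (hP : ∀ i, IsCompact (P i)) (hPne : ∀ i, (P i).Nonempty) (hPconv : ∀ i, Convex ℝ (P i))
    (hQK : ∀ i, Q i ⊆ K i) (hPK : ∀ i, P i ⊆ K i) {u : Fin n → ℝ} (hu : u ≠ 0) {c : Fin n → ℝ}
    (hcQ : ∀ i, ∀ y ∈ Q i, u ⬝ᵥ y < c i) (hcP : ∀ i, ∀ y ∈ P i, c i < u ⬝ᵥ y) :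
    mixedVol Q + mixedVol P ≤ mixedVol K := by
  have hne : ∀ i, (K i).Nonempty := fun i => (hQne i).mono (hQK i)
  obtain ⟨L₁, hL₁, hb₁⟩ := exists_forall_abs_suppFn_le hK hne
  obtain ⟨L₂, hL₂, hb₂⟩ := exists_forall_abs_suppFn_le hQ hQne
  obtain ⟨L₃, hL₃, hb₃⟩ := exists_forall_abs_suppFn_le hP hPne
  have hsQ : ∀ i, 0 < c i - suppFn (Q i) u := fun i => by
    obtain ⟨y, hy, he⟩ := exists_suppFn_eq (hQ i) (hQne i) u
    rw [he]
    exact sub_pos.2 (hcQ i y hy)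
  have hsP : ∀ i, 0 < -suppFn (P i) (-u) - c i := fun i => by
    obtain ⟨y, hy, he⟩ := exists_suppFn_eq (hP i) (hPne i) (-u)
    rw [he, neg_dotProduct, neg_neg]
    exact sub_pos.2 (hcP i y hy)
  refine le_of_tendsto' ((tendsto_setIntegral_mollDisc hQ hQne hQconv
    fun i => isPot_suppFn (hQ i) (hQne i)).add (tendsto_setIntegral_mollDisc hP hPne hPconv
    fun i => isPot_suppFn (hP i) (hPne i))) fun R => ?_
  obtain ⟨N, hN0, hN1, hN2, hN3⟩ : ∃ N : ℝ, 0 ≤ N ∧ 2 * R ≤ N * ‖u‖ ∧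
      (∀ i, (L₂ + L₃) * (R + 1) ≤ N * (c i - suppFn (Q i) u)) ∧
      ∀ i, (L₂ + L₃) * (R + 1) ≤ N * (-suppFn (P i) (-u) - c i) := by
    refine Eventually.exists (f := atTop) ((eventually_ge_atTop 0).and (Eventually.and ?_
      (Eventually.and (eventually_all.2 fun i => ?_) (eventually_all.2 fun i => ?_))))
    · exact (tendsto_id.atTop_mul_const (norm_pos_iff.2 hu)).eventually_ge_atTop _
    · exact (tendsto_id.atTop_mul_const (hsQ i)).eventually_ge_atTop _
    · exact (tendsto_id.atTop_mul_const (hsP i)).eventually_ge_atTop _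
  obtain ⟨C, hC1, hC2⟩ : ∃ C : ℝ, (L₁ + L₂) * (R + 1) ≤ C ∧
      ∀ i, L₁ * (N * ‖u‖ + (R + 1)) + L₃ * (R + 1) - N * c i ≤ C := by
    refine Eventually.exists (f := atTop)
      ((eventually_ge_atTop _).and (eventually_all.2 fun i => ?_))
    exact eventually_ge_atTop _
  have hp : ∀ i, IsPot (K i) fun x => max (suppFn (K i) x - C)
      (max (suppFn (Q i) x) (suppFn (P i) (x - N • u) + N * c i)) := fun i => by
    refine IsPot.max_sub (hK i) (hne i) ?_ fun x v => max_le ?_ ?_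
    · refine (convexOn_suppFn (hQ i) (hQne i)).sup (ConvexOn.add_const ?_ _)
      have := (convexOn_suppFn (hP i) (hPne i)).translate_left (-(N • u))
      simpa [Function.comp_def, sub_eq_add_neg] using this
    · have := suppFn_add_le (hQ i) (hQne i) x v
      have := suppFn_mono (hK i) (hQ i) (hQne i) (hQK i) v
      linarith [le_max_left (suppFn (Q i) x) (suppFn (P i) (x - N • u) + N * c i)]
    · have := suppFn_add_le (hP i) (hPne i) (x - N • u) v
      have := suppFn_mono (hK i) (hP i) (hPne i) (hPK i) v
      rw [show x + v - N • u = x - N • u + v by abel]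
      linarith [le_max_right (suppFn (Q i) x) (suppFn (P i) (x - N • u) + N * c i)]
  have hi := integrable_mollDisc hK hne hconv hp
  have hdisj : Disjoint (Metric.ball (0 : Fin n → ℝ) R) (Metric.ball (N • u) R) := by
    refine Metric.ball_disjoint_ball ?_
    rw [dist_zero_left, norm_smul, Real.norm_of_nonneg hN0]
    linarith
  rw [← hi.2, ← setIntegral_mollDisc_eq (φ := fun i x => max (suppFn (K i) x - C)
      (max (suppFn (Q i) x) (suppFn (P i) (x - N • u) + N * c i)))
    (ψ := fun i => suppFn (Q i)) (p := 0) (c := 0)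
    (fun i => (isPot_suppFn (hQ i) (hQne i)).continuous (hQ i) (hQne i)) (fun i z hz => ?_),
    ← setIntegral_mollDisc_eq (φ := fun i x => max (suppFn (K i) x - C)
      (max (suppFn (Q i) x) (suppFn (P i) (x - N • u) + N * c i)))
    (ψ := fun i => suppFn (P i)) (p := N • u) (c := fun i => N * c i)
    (fun i => (isPot_suppFn (hP i) (hPne i)).continuous (hP i) (hPne i)) (fun i z hz => ?_),
    ← setIntegral_union hdisj measurableSet_ball hi.1.integrableOn hi.1.integrableOn]
  · exact setIntegral_le_integral hi.1 (ae_of_all _ (mollDisc_nonneg hK hne hp))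
  · rw [add_sub_cancel_left]
    have h1 := abs_le.1 (hb₁ i (N • u + z))
    have h2 := abs_le.1 (hb₂ i z)
    have h3 := abs_le.1 (hb₃ i z)
    have h4 : L₁ * ‖N • u + z‖ ≤ L₁ * (N * ‖u‖ + (R + 1)) := by
      gcongr
      refine (norm_add_le _ _).trans ?_
      rw [norm_smul, Real.norm_of_nonneg hN0]
      gcongr
    have h5 : (L₂ + L₃) * ‖z‖ ≤ (L₂ + L₃) * (R + 1) := by gcongr
    have h5' : L₃ * ‖z‖ ≤ L₃ * (R + 1) := by gcongr
    have h6 := suppFn_add_le (hQ i) (hQne i) (N • u) z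
    rw [suppFn_smul (hQ i) (hQne i) hN0] at h6
    have h7 := hN2 i
    have h9 := hC2 i
    have h8 : suppFn (Q i) (N • u + z) ≤ suppFn (P i) z + N * c i := by linarith
    rw [max_eq_right h8]
    refine max_eq_right ?_
    linarith
  · simp only [zero_add, Pi.zero_apply, add_zero]
    have h1 := abs_le.1 (hb₁ i z)
    have h2 := abs_le.1 (hb₂ i z)
    have h3 := abs_le.1 (hb₃ i z)
    have h4 : (L₁ + L₂) * ‖z‖ ≤ (L₁ + L₂) * (R + 1) := by gcongr
    have h5 : (L₂ + L₃) * ‖z‖ ≤ (L₂ + L₃) * (R + 1) := by gcongr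
    have h6 := suppFn_add_le (hP i) (hPne i) z (N • (-u))
    rw [suppFn_smul (hP i) (hPne i) hN0, smul_neg, ← sub_eq_add_neg] at h6
    have h7 := hN3 i
    have h8 : suppFn (P i) (z - N • u) + N * c i ≤ suppFn (Q i) z := by linarith
    rw [max_eq_left h8]
    refine max_eq_right ?_
    linarith

end Superadditivity

section Superadditivity

variable {n : ℕ} {K Q P : Fin n → Set (Fin n → ℝ)}

theorem mixedVol_smul_add_singleton (K : Fin n → Set (Fin n → ℝ)) {r : ℝ} (hr : 0 ≤ r)
    (y : Fin n → Fin n → ℝ) : mixedVol (fun i => r • K i + {y i}) = r ^ n * mixedVol K := by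
  unfold mixedVol altSum
  rw [Finset.mul_sum]
  refine Finset.sum_congr rfl fun S _ => ?_
  beta_reduce
  have h : ∑ i ∈ S, (r • K i + {y i}) = r • ∑ i ∈ S, K i + {∑ i ∈ S, y i} := by
    rw [Finset.sum_add_distrib, Finset.smul_sum]
    congr 1
    exact (map_sum (Set.singletonAddMonoidHom (α := Fin n → ℝ)) y S).symm
  rw [h, Set.add_singleton, Set.image_add_right, measure_preimage_add_right, Measure.addHaar_smul]
  rw [ENNReal.toReal_mul, ENNReal.toReal_ofReal (abs_nonneg _), Module.finrank_fin_fun,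
    abs_of_nonneg (by positivity)]
  ring

theorem smul_add_singleton_subset {A : Set (Fin n → ℝ)} (hA : Convex ℝ A) {y : Fin n → ℝ}
    (hy : y ∈ A) {η : ℝ} (h0 : 0 ≤ η) (h1 : η ≤ 1) : (1 - η) • A + {η • y} ⊆ A := by
  rintro _ ⟨_, ⟨a, ha, rfl⟩, _, rfl, rfl⟩
  exact hA ha hy (by linarith) h0 (by ring)

theorem mixedVol_add_le (hK : ∀ i, IsCompact (K i)) (hconv : ∀ i, Convex ℝ (K i))
    (hQ : ∀ i, IsCompact (Q i)) (hQconv : ∀ i, Convex ℝ (Q i))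
    (hP : ∀ i, IsCompact (P i)) (hPconv : ∀ i, Convex ℝ (P i))
    (hQK : ∀ i, Q i ⊆ K i) (hPK : ∀ i, P i ⊆ K i) {u : Fin n → ℝ} (hu : u ≠ 0) {c : Fin n → ℝ}
    (hcQ : ∀ i, ∀ y ∈ Q i, u ⬝ᵥ y ≤ c i) (hcQ' : ∀ i, ∃ y ∈ Q i, u ⬝ᵥ y < c i)
    (hcP : ∀ i, ∀ y ∈ P i, c i ≤ u ⬝ᵥ y) (hcP' : ∀ i, ∃ y ∈ P i, c i < u ⬝ᵥ y) :
    mixedVol Q + mixedVol P ≤ mixedVol K := by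
  choose a ha ha' using hcQ'
  choose b hb hb' using hcP'
  have key : ∀ η ∈ Set.Ioo (0 : ℝ) 1,
      (1 - η) ^ n * (mixedVol Q + mixedVol P) ≤ mixedVol K := by
    rintro η ⟨h0, h1⟩
    rw [mul_add, ← mixedVol_smul_add_singleton Q (by linarith) fun i => η • a i,
      ← mixedVol_smul_add_singleton P (by linarith) fun i => η • b i]
    refine mixedVol_add_le_of_lt (u := u) (c := c) hK hconv ?_ ?_ ?_ ?_ ?_ ?_ ?_ ?_ hu ?_ ?_
    · exact fun i => ((hQ i).smul _).add isCompact_singleton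
    · exact fun i => (Set.Nonempty.smul_set ⟨_, ha i⟩).add (Set.singleton_nonempty _)
    · exact fun i => ((hQconv i).smul _).add (convex_singleton _)
    · exact fun i => ((hP i).smul _).add isCompact_singleton
    · exact fun i => (Set.Nonempty.smul_set ⟨_, hb i⟩).add (Set.singleton_nonempty _)
    · exact fun i => ((hPconv i).smul _).add (convex_singleton _)
    · exact fun i => (smul_add_singleton_subset (hQconv i) (ha i) h0.le h1.le).trans (hQK i)
    · exact fun i => (smul_add_singleton_subset (hPconv i) (hb i) h0.le h1.le).trans (hPK i)
    · rintro i _ ⟨_, ⟨q, hq, rfl⟩, _, rfl, rfl⟩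
      simp only [dotProduct_add, dotProduct_smul, smul_eq_mul]
      have := mul_le_mul_of_nonneg_left (hcQ i q hq) (by linarith : (0 : ℝ) ≤ 1 - η)
      have := mul_lt_mul_of_pos_left (ha' i) h0
      linarith
    · rintro i _ ⟨_, ⟨q, hq, rfl⟩, _, rfl, rfl⟩
      simp only [dotProduct_add, dotProduct_smul, smul_eq_mul]
      have := mul_le_mul_of_nonneg_left (hcP i q hq) (by linarith : (0 : ℝ) ≤ 1 - η)
      have := mul_lt_mul_of_pos_left (hb' i) h0
      linarith
  have ht : Tendsto (fun η : ℝ => (1 - η) ^ n * (mixedVol Q + mixedVol P)) (𝓝[>] 0)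
      (𝓝 (mixedVol Q + mixedVol P)) := by
    have h : Continuous fun η : ℝ => (1 - η) ^ n * (mixedVol Q + mixedVol P) := by fun_prop
    simpa using (h.tendsto 0).mono_left nhdsWithin_le_nhds
  refine le_of_tendsto ht ?_
  filter_upwards [Ioo_mem_nhdsGT (zero_lt_one (α := ℝ))] with η hη using key η hη

end Superadditivity

section Boxes

variable {n : ℕ} {ι : Type*}

theorem Icc_add_Icc_pi {a b c d : Fin n → ℝ} (hab : a ≤ b) (hcd : c ≤ d) :
    Set.Icc a b + Set.Icc c d = Set.Icc (a + c) (b + d) := by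
  refine Set.Subset.antisymm ?_ fun x hx => ?_
  · rintro _ ⟨y, hy, z, hz, rfl⟩
    exact ⟨add_le_add hy.1 hz.1, add_le_add hy.2 hz.2⟩
  refine ⟨a ⊔ (x - d), ⟨le_sup_left, sup_le hab ?_⟩, x - a ⊔ (x - d), ⟨?_, ?_⟩, by simp⟩
  · exact sub_le_iff_le_add.2 hx.2
  · rw [le_sub_comm]
    refine sup_le ?_ (sub_le_sub_left hcd x)
    rw [le_sub_iff_add_le]
    exact hx.1
  · rw [sub_le_comm]
    exact le_sup_right

theorem sum_Icc_eq {κ : Type*} (S : Finset κ) {a b : κ → Fin n → ℝ} (h : ∀ i, a i ≤ b i) :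
    ∑ i ∈ S, Set.Icc (a i) (b i) = Set.Icc (∑ i ∈ S, a i) (∑ i ∈ S, b i) := by
  classical
  induction S using Finset.induction_on with
  | empty => simp [Set.singleton_zero]
  | insert i S hi ih =>
    rw [Finset.sum_insert hi, Finset.sum_insert hi, Finset.sum_insert hi, ih]
    exact Icc_add_Icc_pi (h i) (Finset.sum_le_sum fun i _ => h i)

theorem le_mixedVol_Icc {a b : Fin n → Fin n → ℝ} (h : ∀ i, a i ≤ b i) :
    n.factorial * ∏ i, (∏ k, (b i k - a i k)) ^ ((n : ℝ)⁻¹)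
      ≤ mixedVol fun i => Set.Icc (a i) (b i) := by
  refine (factorial_mul_prod_rpow_le_sum_perm (fun i k => b i k - a i k)
    fun i k => sub_nonneg.2 (h i k)).trans_eq ?_
  rw [← altSum_prod_sum fun i k => b i k - a i k, mixedVol]
  congr 1
  ext S
  rw [sum_Icc_eq S h, Real.volume_Icc_pi_toReal (Finset.sum_le_sum fun i _ => h i)]
  simp [Finset.sum_sub_distrib]

/-- The total volume of the boxes `[a j, b j]`, `j ∈ J`. -/
noncomputable def boxVol (J : Finset ι) (a b : ι → Fin n → ℝ) : ℝ :=
  ∑ j ∈ J, ∏ k, (b j k - a j k)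

/-- The boxes meeting the open half space `{x | x k < c}`. -/
noncomputable def lowIdx (k : Fin n) (c : ℝ) (J : Finset ι) (a : ι → Fin n → ℝ) : Finset ι :=
  {j ∈ J | a j k < c}

/-- The boxes meeting the open half space `{x | c < x k}`. -/
noncomputable def upIdx (k : Fin n) (c : ℝ) (J : Finset ι) (b : ι → Fin n → ℝ) : Finset ι :=
  {j ∈ J | c < b j k}

/-- The upper corners of the boxes after cutting with `{x | x k ≤ c}`. -/
noncomputable def lowCorner (k : Fin n) (c : ℝ) (b : ι → Fin n → ℝ) (j : ι) : Fin n → ℝ :=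
  Function.update (b j) k (min (b j k) c)

/-- The lower corners of the boxes after cutting with `{x | c ≤ x k}`. -/
noncomputable def upCorner (k : Fin n) (c : ℝ) (a : ι → Fin n → ℝ) (j : ι) : Fin n → ℝ :=
  Function.update (a j) k (max (a j k) c)

variable {J : Finset ι} {a b : ι → Fin n → ℝ} {k : Fin n} {c : ℝ}

theorem boxVol_pos (hJ : J.Nonempty) (h : ∀ j ∈ J, ∀ k, a j k < b j k) : 0 < boxVol J a b :=
  Finset.sum_pos (fun j hj => Finset.prod_pos fun k _ => sub_pos.2 (h j hj k)) hJ

theorem boxVol_low_eq (h : ∀ j ∈ J, ∀ k, a j k < b j k) :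
    boxVol (lowIdx k c J a) a (lowCorner k c b) =
      ∑ j ∈ J, max 0 (min (b j k) c - a j k) * ∏ r ∈ Finset.univ.erase k, (b j r - a j r) := by
  rw [boxVol, lowIdx, Finset.sum_filter]
  refine Finset.sum_congr rfl fun j hj => ?_
  split_ifs with hc
  · rw [← Finset.mul_prod_erase _ _ (Finset.mem_univ k),
      max_eq_right (sub_nonneg.2 (le_min (h j hj k).le hc.le))]
    congr 1
    · simp [lowCorner]
    · refine Finset.prod_congr rfl fun r hr => ?_
      simp [lowCorner, Finset.ne_of_mem_erase hr]
  · rw [max_eq_left, zero_mul]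
    linarith [min_le_right (b j k) c]

theorem boxVol_up_eq (h : ∀ j ∈ J, ∀ k, a j k < b j k) :
    boxVol (upIdx k c J b) (upCorner k c a) b =
      ∑ j ∈ J, max 0 (b j k - max (a j k) c) * ∏ r ∈ Finset.univ.erase k, (b j r - a j r) := by
  rw [boxVol, upIdx, Finset.sum_filter]
  refine Finset.sum_congr rfl fun j hj => ?_
  split_ifs with hc
  · rw [← Finset.mul_prod_erase _ _ (Finset.mem_univ k),
      max_eq_right (sub_nonneg.2 (max_le (h j hj k).le hc.le))]
    congr 1
    · simp [upCorner]
    · refine Finset.prod_congr rfl fun r hr => ?_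
      simp [upCorner, Finset.ne_of_mem_erase hr]
  · rw [max_eq_left, zero_mul]
    linarith [le_max_right (a j k) c]

theorem boxVol_low_add_up (h : ∀ j ∈ J, ∀ k, a j k < b j k) :
    boxVol (lowIdx k c J a) a (lowCorner k c b) + boxVol (upIdx k c J b) (upCorner k c a) b =
      boxVol J a b := by
  rw [boxVol_low_eq h, boxVol_up_eq h, ← Finset.sum_add_distrib, boxVol]
  refine Finset.sum_congr rfl fun j hj => ?_
  rw [← Finset.mul_prod_erase _ _ (Finset.mem_univ k), ← add_mul]
  congr 1
  have := h j hj k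
  rcases le_total (b j k) c with h1 | h1 <;> rcases le_total (a j k) c with h2 | h2 <;>
    simp only [min_eq_left, min_eq_right, max_eq_left, max_eq_right, h1, h2] <;>
    rcases max_cases 0 (b j k - a j k) <;> rcases max_cases 0 (c - a j k) <;>
    rcases max_cases 0 (b j k - c) <;> linarith

theorem exists_boxVol_low_eq (k : Fin n) (hJ : J.Nonempty) (h : ∀ j ∈ J, ∀ k, a j k < b j k) {t : ℝ}
    (h0 : 0 < t) (h1 : t < 1) :
    ∃ c, boxVol (lowIdx k c J a) a (lowCorner k c b) = t * boxVol J a b := by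
  have hpos := boxVol_pos hJ h
  have hcont : Continuous fun c => boxVol (lowIdx k c J a) a (lowCorner k c b) := by
    simp only [boxVol_low_eq h]
    fun_prop
  obtain ⟨c₀, hc₀⟩ := (J.finite_toSet.image fun j => a j k).bddBelow
  obtain ⟨c₁, hc₁⟩ := (J.finite_toSet.image fun j => b j k).bddAbove
  refine mem_range_of_exists_le_of_exists_ge hcont ⟨c₀, ?_⟩ ⟨c₁, ?_⟩
  · have : lowIdx k c₀ J a = ∅ :=
      Finset.filter_false_of_mem fun j hj => not_lt.2 (hc₀ ⟨j, hj, rfl⟩)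
    rw [this, boxVol, Finset.sum_empty]
    positivity
  · have : upIdx k c₁ J b = ∅ :=
      Finset.filter_false_of_mem fun j hj => not_lt.2 (hc₁ ⟨j, hj, rfl⟩)
    have h2 := boxVol_low_add_up (k := k) (c := c₁) h
    rw [this, boxVol, boxVol, Finset.sum_empty, add_zero, ← boxVol] at h2
    rw [h2]
    nlinarith

theorem low_lt (h : ∀ j ∈ J, ∀ k, a j k < b j k) :
    ∀ j ∈ lowIdx k c J a, ∀ r, a j r < lowCorner k c b j r := by
  intro j hj r
  rw [lowIdx, Finset.mem_filter] at hj
  rcases eq_or_ne r k with rfl | hr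
  · simpa [lowCorner] using ⟨h j hj.1 r, hj.2⟩
  · simpa [lowCorner, hr] using h j hj.1 r

theorem up_lt (h : ∀ j ∈ J, ∀ k, a j k < b j k) :
    ∀ j ∈ upIdx k c J b, ∀ r, upCorner k c a j r < b j r := by
  intro j hj r
  rw [upIdx, Finset.mem_filter] at hj
  rcases eq_or_ne r k with rfl | hr
  · simpa [upCorner] using ⟨h j hj.1 r, hj.2⟩
  · simpa [upCorner, hr] using h j hj.1 r

theorem lowCorner_le (j : ι) : lowCorner k c b j ≤ b j := by
  intro r
  rcases eq_or_ne r k with rfl | hr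
  · simp [lowCorner]
  · simp [lowCorner, hr]

theorem le_upCorner (j : ι) : a j ≤ upCorner k c a j := by
  intro r
  rcases eq_or_ne r k with rfl | hr
  · simp [upCorner]
  · simp [upCorner, hr]

theorem lowCorner_apply_le (j : ι) : lowCorner k c b j k ≤ c := by simp [lowCorner]

theorem le_upCorner_apply (j : ι) : c ≤ upCorner k c a j k := by simp [upCorner]

end Boxes

section HadwigerOhmann

variable {n : ℕ} {ι : Type*}

/-- The boxes `[a j, b j]`, `j ∈ J`, are pairwise separated by coordinate hyperplanes. -/
def BoxSep (J : Finset ι) (a b : ι → Fin n → ℝ) : Prop :=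
  ∀ j ∈ J, ∀ j' ∈ J, j ≠ j' → ∃ k, b j k ≤ a j' k ∨ b j' k ≤ a j k

theorem BoxSep.mono {J J' : Finset ι} {a b a' b' : ι → Fin n → ℝ} (h : BoxSep J a b)
    (hJ : J' ⊆ J) (ha : ∀ j, a j ≤ a' j) (hb : ∀ j, b' j ≤ b j) : BoxSep J' a' b' := by
  intro j hj j' hj' hne
  obtain ⟨k, h⟩ := h j (hJ hj) j' (hJ hj') hne
  exact ⟨k, h.imp (fun h => (hb j k).trans (h.trans (ha j' k)))
    fun h => (hb j' k).trans (h.trans (ha j k))⟩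

theorem prod_mul_rpow_inv (hn : n ≠ 0) {t : ℝ} (ht : 0 ≤ t) {v : Fin n → ℝ} (hv : ∀ i, 0 ≤ v i) :
    ∏ i, (t * v i) ^ ((n : ℝ)⁻¹) = t * ∏ i, v i ^ ((n : ℝ)⁻¹) := by
  simp_rw [Real.mul_rpow ht (hv _)]
  rw [Finset.prod_mul_distrib, Finset.prod_const, Finset.card_univ, Fintype.card_fin,
    Real.rpow_inv_natCast_pow ht hn]

theorem le_mixedVol_of_boxes (m : ℕ) : ∀ (J : Fin n → Finset ι) (a b : Fin n → ι → Fin n → ℝ)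
    (K : Fin n → Set (Fin n → ℝ)), ∑ i, (J i).card = m → (∀ i, (J i).Nonempty) →
    (∀ i, ∀ j ∈ J i, ∀ k, a i j k < b i j k) → (∀ i, BoxSep (J i) (a i) (b i)) →
    (∀ i, IsCompact (K i)) → (∀ i, Convex ℝ (K i)) →
    (∀ i, ∀ j ∈ J i, Set.Icc (a i j) (b i j) ⊆ K i) →
    n.factorial * ∏ i, (boxVol (J i) (a i) (b i)) ^ ((n : ℝ)⁻¹) ≤ mixedVol K := by
  classical
  induction m using Nat.strong_induction_on with
  | _ m ih =>
  intro J a b K hm hJ hlt hsep hK hconv hsub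
  by_cases hone : ∀ i, (J i).card = 1
  · choose j hj using fun i => Finset.card_eq_one.1 (hone i)
    have hmem : ∀ i, j i ∈ J i := fun i => by simp [hj]
    have hle : ∀ i, a i (j i) ≤ b i (j i) := fun i k => (hlt i _ (hmem i) k).le
    have h1 := le_mixedVol_Icc (a := fun i => a i (j i)) (b := fun i => b i (j i)) hle
    have h2 := mixedVol_mono hK hconv (fun i => isCompact_Icc (a := a i (j i)) (b := b i (j i)))
      (fun i => Set.nonempty_Icc.2 (hle i)) (fun i => convex_Icc _ _) fun i => hsub i _ (hmem i)
    refine le_trans (le_of_eq ?_) (h1.trans h2)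
    simp only [boxVol, hj, Finset.sum_singleton]
  · push Not at hone
    obtain ⟨i₀, hi₀⟩ := hone
    have hn : n ≠ 0 := fun h => by subst h; exact i₀.elim0
    obtain ⟨k, c₀, hlow₀, hup₀, hlowc, hupc⟩ : ∃ k c₀, (lowIdx k c₀ (J i₀) (a i₀)).Nonempty ∧
        (upIdx k c₀ (J i₀) (b i₀)).Nonempty ∧
        (lowIdx k c₀ (J i₀) (a i₀)).card < (J i₀).card ∧
        (upIdx k c₀ (J i₀) (b i₀)).card < (J i₀).card := by
      have hcard : 1 < (J i₀).card := by
        have := (hJ i₀).card_pos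
        omega
      obtain ⟨j₁, h₁, j₂, h₂, hne, k, hk⟩ : ∃ j₁ ∈ J i₀, ∃ j₂ ∈ J i₀, j₁ ≠ j₂ ∧
          ∃ k, b i₀ j₁ k ≤ a i₀ j₂ k := by
        obtain ⟨j₁, h₁, j₂, h₂, hne⟩ := Finset.one_lt_card.1 hcard
        obtain ⟨k, hk | hk⟩ := hsep i₀ j₁ h₁ j₂ h₂ hne
        · exact ⟨j₁, h₁, j₂, h₂, hne, k, hk⟩
        · exact ⟨j₂, h₂, j₁, h₁, hne.symm, k, hk⟩
      have h₃ := hlt i₀ j₁ h₁ k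
      have h₄ := hlt i₀ j₂ h₂ k
      refine ⟨k, a i₀ j₂ k, ⟨j₁, ?_⟩, ⟨j₂, ?_⟩, Finset.card_lt_card ?_, Finset.card_lt_card ?_⟩
      · simpa [lowIdx, h₁] using h₃.trans_le hk
      · simpa [upIdx, h₂] using h₄
      · exact Finset.filter_ssubset.2 ⟨j₂, h₂, lt_irrefl _⟩
      · exact Finset.filter_ssubset.2 ⟨j₁, h₁, not_lt.2 hk⟩
    have hv : ∀ i, 0 < boxVol (J i) (a i) (b i) := fun i => boxVol_pos (hJ i) (hlt i)
    obtain ⟨t, ht0, ht1, htv⟩ : ∃ t, 0 < t ∧ t < 1 ∧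
        boxVol (lowIdx k c₀ (J i₀) (a i₀)) (a i₀) (lowCorner k c₀ (b i₀)) =
          t * boxVol (J i₀) (a i₀) (b i₀) := by
      have h1 := boxVol_pos hlow₀ (low_lt (hlt i₀))
      have h2 := boxVol_pos hup₀ (up_lt (hlt i₀))
      have h3 := boxVol_low_add_up (k := k) (c := c₀) (hlt i₀)
      refine ⟨_, div_pos h1 (hv i₀), (div_lt_one (hv i₀)).2 (by linarith),
        (div_mul_cancel₀ _ (hv i₀).ne').symm⟩
    obtain ⟨c, hc0, hc⟩ : ∃ c : Fin n → ℝ, c i₀ = c₀ ∧ ∀ i,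
        boxVol (lowIdx k (c i) (J i) (a i)) (a i) (lowCorner k (c i) (b i)) =
          t * boxVol (J i) (a i) (b i) := by
      choose c hc using fun i => exists_boxVol_low_eq k (hJ i) (hlt i) ht0 ht1
      refine ⟨Function.update c i₀ c₀, by simp, fun i => ?_⟩
      rcases eq_or_ne i i₀ with rfl | hi
      · simpa using htv
      · simpa [hi] using hc i
    have hc' : ∀ i, boxVol (upIdx k (c i) (J i) (b i)) (upCorner k (c i) (a i)) (b i) =
        (1 - t) * boxVol (J i) (a i) (b i) := fun i => by
      have := boxVol_low_add_up (k := k) (c := c i) (hlt i)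
      linarith [hc i]
    have hlowne : ∀ i, (lowIdx k (c i) (J i) (a i)).Nonempty := fun i => by
      by_contra h
      have h1 := hc i
      rw [Finset.not_nonempty_iff_eq_empty.1 h, boxVol, Finset.sum_empty] at h1
      linarith [mul_pos ht0 (hv i)]
    have hupne : ∀ i, (upIdx k (c i) (J i) (b i)).Nonempty := fun i => by
      by_contra h
      have h1 := hc' i
      rw [Finset.not_nonempty_iff_eq_empty.1 h, boxVol, Finset.sum_empty] at h1
      linarith [mul_pos (sub_pos.2 ht1) (hv i)]
    have hcont : Continuous fun y : Fin n → ℝ => y k := continuous_apply k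
    have hlin : IsLinearMap ℝ fun y : Fin n → ℝ => y k := ⟨fun _ _ => rfl, fun _ _ => rfl⟩
    have hQ : ∀ i, IsCompact (K i ∩ {y | y k ≤ c i}) := fun i =>
      (hK i).inter_right (isClosed_le hcont continuous_const)
    have hP : ∀ i, IsCompact (K i ∩ {y | c i ≤ y k}) := fun i =>
      (hK i).inter_right (isClosed_le continuous_const hcont)
    have hQc : ∀ i, Convex ℝ (K i ∩ {y | y k ≤ c i}) := fun i =>
      (hconv i).inter (convex_halfSpace_le hlin _)
    have hPc : ∀ i, Convex ℝ (K i ∩ {y | c i ≤ y k}) := fun i =>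
      (hconv i).inter (convex_halfSpace_ge hlin _)
    have hlowsub : ∀ i, ∀ j ∈ lowIdx k (c i) (J i) (a i),
        Set.Icc (a i j) (lowCorner k (c i) (b i) j) ⊆ K i ∩ {y | y k ≤ c i} :=
      fun i j hj y hy => ⟨hsub i j (Finset.mem_filter.1 hj).1 ⟨hy.1, hy.2.trans (lowCorner_le j)⟩,
        (hy.2 k).trans (lowCorner_apply_le j)⟩
    have hupsub : ∀ i, ∀ j ∈ upIdx k (c i) (J i) (b i),
        Set.Icc (upCorner k (c i) (a i) j) (b i j) ⊆ K i ∩ {y | c i ≤ y k} :=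
      fun i j hj y hy => ⟨hsub i j (Finset.mem_filter.1 hj).1 ⟨(le_upCorner j).trans hy.1, hy.2⟩,
        (le_upCorner_apply j).trans (hy.1 k)⟩
    have hadd : mixedVol (fun i => K i ∩ {y | y k ≤ c i}) +
        mixedVol (fun i => K i ∩ {y | c i ≤ y k}) ≤ mixedVol K := by
      refine mixedVol_add_le (u := Pi.single k 1) (c := c) hK hconv hQ hQc hP hPc
        (fun i => Set.inter_subset_left) (fun i => Set.inter_subset_left) ?_ ?_ ?_ ?_ ?_
      · exact fun h => one_ne_zero (α := ℝ) (by simpa using congrFun h k)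
      all_goals simp only [single_one_dotProduct]
      · exact fun i y hy => hy.2
      · intro i
        obtain ⟨j, hj⟩ := hlowne i
        refine ⟨a i j, hlowsub i j hj (Set.left_mem_Icc.2 fun r => (low_lt (hlt i) j hj r).le), ?_⟩
        exact (Finset.mem_filter.1 hj).2
      · exact fun i y hy => hy.2
      · intro i
        obtain ⟨j, hj⟩ := hupne i
        refine ⟨b i j, hupsub i j hj (Set.right_mem_Icc.2 fun r => (up_lt (hlt i) j hj r).le), ?_⟩
        exact (Finset.mem_filter.1 hj).2
    have h1 := ih _ (by
        rw [← hm]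
        refine Finset.sum_lt_sum (fun i _ => Finset.card_filter_le _ _) ⟨i₀, Finset.mem_univ _, ?_⟩
        rw [hc0]; exact hlowc)
      (fun i => lowIdx k (c i) (J i) (a i)) a (fun i => lowCorner k (c i) (b i)) _ rfl hlowne
      (fun i => low_lt (hlt i)) (fun i => (hsep i).mono (Finset.filter_subset _ _)
        (fun j => le_rfl) lowCorner_le) hQ hQc hlowsub
    have h2 := ih _ (by
        rw [← hm]
        refine Finset.sum_lt_sum (fun i _ => Finset.card_filter_le _ _) ⟨i₀, Finset.mem_univ _, ?_⟩
        rw [hc0]; exact hupc)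
      (fun i => upIdx k (c i) (J i) (b i)) (fun i => upCorner k (c i) (a i)) b _ rfl hupne
      (fun i => up_lt (hlt i)) (fun i => (hsep i).mono (Finset.filter_subset _ _)
        le_upCorner fun j => le_rfl) hP hPc hupsub
    simp only [hc] at h1
    simp only [hc'] at h2
    rw [prod_mul_rpow_inv hn ht0.le fun i => (hv i).le] at h1
    rw [prod_mul_rpow_inv hn (sub_nonneg.2 ht1.le) fun i => (hv i).le] at h2
    linarith

end HadwigerOhmann

section Minkowski

variable {n : ℕ}

theorem closedBall_eq_Icc_pi (x : Fin n → ℝ) {r : ℝ} (hr : 0 ≤ r) :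
    Metric.closedBall x r = Set.Icc (fun k => x k - r) (fun k => x k + r) := by
  simp only [closedBall_pi x hr, Real.closedBall_eq_Icc, Set.pi_univ_Icc]

theorem exists_boxes_le {K : Set (Fin n → ℝ)} (hK : IsCompact K) (hconv : Convex ℝ K) {m : ℝ}
    (h0 : 0 ≤ m) (hm : m < (volume K).toReal) :
    ∃ (J : Finset (Fin n → ℝ)) (a b : (Fin n → ℝ) → Fin n → ℝ), J.Nonempty ∧
      (∀ j ∈ J, ∀ k, a j k < b j k) ∧ BoxSep J a b ∧ (∀ j ∈ J, Set.Icc (a j) (b j) ⊆ K) ∧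
      m ≤ boxVol J a b := by
  have hvol : volume (interior K) = volume K := by
    refine le_antisymm (measure_mono interior_subset) ?_
    have h1 : K ⊆ interior K ∪ frontier K := by
      rw [← closure_eq_interior_union_frontier]; exact subset_closure
    refine (measure_mono h1).trans ((measure_union_le _ _).trans ?_)
    rw [hconv.addHaar_frontier volume, add_zero]
  obtain ⟨t, r, htc, hts, hr, hcov, hdisj⟩ := Besicovitch.exists_disjoint_closedBall_covering_ae
    (volume : Measure (Fin n → ℝ)) (fun x => {r | Metric.closedBall x r ⊆ K}) (interior K)
    (fun x hx δ hδ => by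
      obtain ⟨ε, hε, hs⟩ := Metric.nhds_basis_closedBall.mem_iff.1 (isOpen_interior.mem_nhds hx)
      have hpos : 0 < min ε (δ / 2) := lt_min hε (half_pos hδ)
      refine ⟨min ε (δ / 2), ?_, hpos, (min_le_right _ _).trans_lt (half_lt_self hδ)⟩
      exact (Metric.closedBall_subset_closedBall (min_le_left _ _)).trans
        (hs.trans interior_subset))
    (fun _ => 1) fun _ _ => one_pos
  have hle : volume K ≤ ∑' x : t, volume (Metric.closedBall (x : Fin n → ℝ) (r x)) := by
    rw [← hvol]
    refine (measure_le_inter_add_sdiff volume _ (⋃ x ∈ t, Metric.closedBall x (r x))).trans ?_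
    rw [hcov, add_zero]
    exact (measure_mono Set.inter_subset_right).trans (measure_biUnion_le _ htc _)
  have hm' : ENNReal.ofReal m < ∑' x : t, volume (Metric.closedBall (x : Fin n → ℝ) (r x)) :=
    ((ENNReal.ofReal_lt_iff_lt_toReal h0 hK.measure_lt_top.ne).2 hm).trans_le hle
  rw [ENNReal.tsum_eq_iSup_sum, lt_iSup_iff] at hm'
  obtain ⟨F, hF⟩ := hm'
  have hrp : ∀ x ∈ t, 0 < r x := fun x hx => (hr x hx).2.1
  have hJ : ∀ j ∈ F.map (Function.Embedding.subtype (· ∈ t)), j ∈ t := by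
    simp only [Finset.mem_map]
    rintro _ ⟨x, _, rfl⟩
    exact x.2
  refine ⟨F.map (Function.Embedding.subtype _), fun x k => x k - r x, fun x k => x k + r x,
    ?_, ?_, ?_, ?_, ?_⟩
  · rw [Finset.map_nonempty, Finset.nonempty_iff_ne_empty]
    rintro rfl
    simp at hF
  · intro j hj k
    have := hrp j (hJ j hj)
    linarith
  · intro j hj j' hj' hne
    by_contra! hcon
    have hd := hdisj (hJ j hj) (hJ j' hj') hne
    have hp := hrp j (hJ j hj)
    have hp' := hrp j' (hJ j' hj')
    simp only [Function.onFun, closedBall_eq_Icc_pi _ hp.le, closedBall_eq_Icc_pi _ hp'.le] at hd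
    have hmem : (fun k => max (j k - r j) (j' k - r j')) ∈
        Set.Icc (fun k => j k - r j) fun k => j k + r j :=
      ⟨fun k => le_max_left _ _, fun k => max_le (by linarith) (hcon k).1.le⟩
    exact Set.disjoint_left.1 hd hmem
      ⟨fun k => le_max_right _ _, fun k => max_le (hcon k).2.le (by linarith)⟩
  · intro j hj
    rw [← closedBall_eq_Icc_pi _ (hrp j (hJ j hj)).le]
    exact (hr j (hJ j hj)).1
  · rw [boxVol, Finset.sum_map]
    refine (ENNReal.ofReal_le_ofReal_iff (Finset.sum_nonneg fun x _ =>
      Finset.prod_nonneg fun k _ => ?_)).1 (hF.le.trans_eq ?_)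
    · have := hrp x x.2
      simp only [Function.Embedding.subtype_apply]
      linarith
    · rw [ENNReal.ofReal_sum_of_nonneg]
      · refine Finset.sum_congr rfl fun x _ => ?_
        rw [Real.volume_pi_closedBall _ (hrp x x.2).le]
        simp [two_mul]
      · intro x _
        refine Finset.prod_nonneg fun k _ => ?_
        have := hrp x x.2
        simp only [Function.Embedding.subtype_apply]
        linarith

theorem factorial_mul_prod_le_mixedVol (hn : n ≠ 0) {K : Fin n → Set (Fin n → ℝ)}
    (hK : ∀ i, IsCompact (K i)) (hne : ∀ i, (K i).Nonempty) (hconv : ∀ i, Convex ℝ (K i)) :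
    n.factorial * ∏ i, (volume (K i)).toReal ^ ((n : ℝ)⁻¹) ≤ mixedVol K := by
  by_cases hpos : ∀ i, 0 < (volume (K i)).toReal
  · have key : ∀ t ∈ Set.Ioo (0 : ℝ) 1,
        t * (n.factorial * ∏ i, (volume (K i)).toReal ^ ((n : ℝ)⁻¹)) ≤ mixedVol K := by
      rintro t ⟨h0, h1⟩
      choose J a b hJ hlt hsep hsub hle using fun i => exists_boxes_le (hK i) (hconv i)
        (mul_pos h0 (hpos i)).le (mul_lt_of_lt_one_left (hpos i) h1)
      refine le_trans ?_ (le_mixedVol_of_boxes _ J a b K rfl hJ hlt hsep hK hconv hsub)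
      rw [mul_left_comm, ← prod_mul_rpow_inv hn h0.le fun i => (hpos i).le]
      have : ∀ i, 0 ≤ t * (volume (K i)).toReal := fun i => (mul_pos h0 (hpos i)).le
      gcongr with i _
      exact hle i
    have ht : Tendsto (fun t : ℝ => t * (n.factorial * ∏ i, (volume (K i)).toReal ^ ((n : ℝ)⁻¹)))
        (𝓝[<] 1) (𝓝 (n.factorial * ∏ i, (volume (K i)).toReal ^ ((n : ℝ)⁻¹))) := by
      have h : Continuous fun t : ℝ =>
          t * (n.factorial * ∏ i, (volume (K i)).toReal ^ ((n : ℝ)⁻¹)) := by fun_prop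
      simpa using (h.tendsto 1).mono_left nhdsWithin_le_nhds
    refine le_of_tendsto ht ?_
    filter_upwards [Ioo_mem_nhdsLT (zero_lt_one (α := ℝ))] with t ht using key t ht
  · push Not at hpos
    obtain ⟨i, hi⟩ := hpos
    rw [Finset.prod_eq_zero (Finset.mem_univ i), mul_zero]
    · exact mixedVol_nonneg hK hne hconv
    · rw [le_antisymm hi ENNReal.toReal_nonneg,
        Real.zero_rpow (inv_ne_zero (Nat.cast_ne_zero.2 hn))]

end Minkowski

theorem altSum_const_mul {n : ℕ} (c : ℝ) (F : Finset (Fin n) → ℝ) :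
    altSum (fun S => c * F S) = c * altSum F := by
  unfold altSum
  rw [Finset.mul_sum]
  exact Finset.sum_congr rfl fun S _ => by ring

theorem sum_closure_subset_closure_sum {ι E : Type*} [NormedAddCommGroup E] (S : Finset ι)
    (B : ι → Set E) :
    ∑ i ∈ S, closure (B i) ⊆ closure (∑ i ∈ S, B i) := by
  classical
  induction S using Finset.induction_on with
  | empty => simp
  | insert i S hi ih =>
    rw [Finset.sum_insert hi, Finset.sum_insert hi]
    refine (Set.add_subset_add_left ih).trans ?_
    rintro _ ⟨x, hx, y, hy, rfl⟩
    exact map_mem_closure₂ continuous_add hx hy fun a ha b hb => Set.add_mem_add ha hb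

section ConvexVolume

variable {E : Type*} [NormedAddCommGroup E] [NormedSpace ℝ E] [FiniteDimensional ℝ E]
  [MeasurableSpace E] [BorelSpace E] (μ : Measure E) [μ.IsAddHaarMeasure]

theorem measure_closure_of_convex {B : Set E} (hB : Convex ℝ B) : μ (closure B) = μ B := by
  refine le_antisymm ?_ (measure_mono subset_closure)
  rw [closure_eq_self_union_frontier]
  refine (measure_union_le _ _).trans ?_
  rw [hB.addHaar_frontier μ, add_zero]

theorem finset_sum_subset_sum {ι E : Type*} [AddCommMonoid E] (S : Finset ι) {A B : ι → Set E}
    (h : ∀ i ∈ S, A i ⊆ B i) : ∑ i ∈ S, A i ⊆ ∑ i ∈ S, B i := by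
  intro x hx
  rw [Set.mem_finsetSum] at hx ⊢
  obtain ⟨g, hg, rfl⟩ := hx
  exact ⟨g, fun hi => h _ hi (hg hi), rfl⟩

theorem finset_sum_subset_of_zero_mem {ι E : Type*} [AddCommMonoid E] {S T : Finset ι}
    (hST : S ⊆ T) {A : ι → Set E} (h : ∀ i, (0 : E) ∈ A i) : ∑ i ∈ S, A i ⊆ ∑ i ∈ T, A i := by
  classical
  intro x hx
  rw [Set.mem_finsetSum] at hx ⊢
  obtain ⟨g, hg, rfl⟩ := hx
  refine ⟨fun i => if i ∈ S then g i else 0, fun {i} _ => ?_, ?_⟩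
  · by_cases hi : i ∈ S
    · simpa [hi] using hg hi
    · simpa [hi] using h i
  · rw [Finset.sum_ite_mem, Finset.inter_eq_right.2 hST]

theorem measure_sum_closure {ι : Type*} (S : Finset ι) {B : ι → Set E}
    (hB : ∀ i, Convex ℝ (B i)) : μ (∑ i ∈ S, closure (B i)) = μ (∑ i ∈ S, B i) := by
  refine le_antisymm ?_ (measure_mono (finset_sum_subset_sum S fun i _ => subset_closure))
  rw [← measure_closure_of_convex μ (convex_finset_sum S hB)]
  exact measure_mono (sum_closure_subset_closure_sum S B)

end ConvexVolume

section Euclidean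

variable {n : ℕ}

theorem volume_sum_image_ofLp (S : Finset (Fin n)) {A : Fin n → Set (EuclideanSpace ℝ (Fin n))}
    (hA : ∀ i, Convex ℝ (A i)) :
    volume (∑ i ∈ S, closure (WithLp.ofLp '' A i : Set (Fin n → ℝ))) =
      volume (∑ i ∈ S, A i) := by
  have hconv : ∀ i, Convex ℝ (WithLp.ofLp '' A i : Set (Fin n → ℝ)) := fun i =>
    (hA i).linear_image (WithLp.linearEquiv 2 ℝ (Fin n → ℝ)).toLinearMap
  rw [measure_sum_closure volume S hconv]
  have h1 : ∑ i ∈ S, (WithLp.ofLp '' A i : Set (Fin n → ℝ)) = WithLp.ofLp '' ∑ i ∈ S, A i :=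
    (Set.image_finsetSum (WithLp.linearEquiv 2 ℝ (Fin n → ℝ)) S A).symm
  rw [h1, ← (PiLp.volume_preserving_toLp (Fin n)).measure_preimage
    ((convex_finset_sum S hA).nullMeasurableSet (μ := volume))]
  congr 1
  ext x
  constructor
  · rintro ⟨y, hy, rfl⟩
    simpa using hy
  · intro hx
    exact ⟨_, hx, by simp⟩

theorem factorial_mul_prod_le_altSum (hn : n ≠ 0) {A : Fin n → Set (EuclideanSpace ℝ (Fin n))}
    (hA : ∀ i, Convex ℝ (A i)) (hb : ∀ i, Bornology.IsBounded (A i)) (hne : ∀ i, (A i).Nonempty) :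
    n.factorial * ∏ i, (volume (A i)).toReal ^ ((n : ℝ)⁻¹) ≤
      altSum fun S => (volume (∑ i ∈ S, A i)).toReal := by
  have hK : ∀ i, IsCompact (closure (WithLp.ofLp '' A i : Set (Fin n → ℝ))) := fun i => by
    have h := (hb i).isCompact_closure.image (PiLp.continuous_ofLp 2 fun _ : Fin n => ℝ)
    exact h.closure_of_subset (Set.image_mono subset_closure)
  have h := factorial_mul_prod_le_mixedVol hn hK (fun i => ((hne i).image _).closure)
    fun i => ((hA i).linear_image (WithLp.linearEquiv 2 ℝ (Fin n → ℝ)).toLinearMap).closure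
  have h1 : ∀ i,
      volume (closure (WithLp.ofLp '' A i : Set (Fin n → ℝ))) = volume (A i) := fun i => by
    simpa using volume_sum_image_ofLp {i} hA
  simpa only [h1, mixedVol, volume_sum_image_ofLp _ hA] using h

theorem volume_closedBall_eq (r : ℝ) (hr : 0 ≤ r) :
    volume (Metric.closedBall (0 : EuclideanSpace ℝ (Fin n)) r) =
      ENNReal.ofReal (r ^ n) * volume (Metric.ball (0 : EuclideanSpace ℝ (Fin n)) 1) := by
  rw [Measure.addHaar_closedBall volume _ hr, finrank_euclideanSpace_fin]

theorem volume_sum_of_ball_subset (hn : n ≠ 0) (S : Finset (Fin n))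
    {B : Fin n → Set (EuclideanSpace ℝ (Fin n))} {R : Fin n → ℝ} (hR : ∀ i, 0 ≤ R i)
    (h0 : ∀ i, 0 ∈ B i) (h1 : ∀ i, Metric.ball 0 (R i) ⊆ B i)
    (h2 : ∀ i, B i ⊆ Metric.closedBall 0 (R i)) :
    volume (∑ i ∈ S, B i) = ENNReal.ofReal ((∑ i ∈ S, R i) ^ n) *
      volume (Metric.ball (0 : EuclideanSpace ℝ (Fin n)) 1) := by
  have hS : 0 ≤ ∑ i ∈ S, R i := Finset.sum_nonneg fun i _ => hR i
  rw [← volume_closedBall_eq _ hS]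
  refine le_antisymm (measure_mono fun x hx => ?_) ?_
  · rw [Set.mem_finsetSum] at hx
    obtain ⟨g, hg, rfl⟩ := hx
    rw [mem_closedBall_zero_iff]
    refine (norm_sum_le _ _).trans (Finset.sum_le_sum fun i hi => ?_)
    simpa using h2 i (hg hi)
  · have : Nonempty (Fin n) := ⟨⟨0, Nat.pos_of_ne_zero hn⟩⟩
    rw [Measure.addHaar_closedBall_eq_addHaar_ball]
    refine measure_mono fun x hx => ?_
    rw [mem_ball_zero_iff] at hx
    rw [Set.mem_finsetSum]
    have hpos : 0 < ∑ i ∈ S, R i := (norm_nonneg _).trans_lt hx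
    refine ⟨fun i => (R i / ∑ i ∈ S, R i) • x, fun {i} _ => ?_, ?_⟩
    · rcases (hR i).eq_or_lt with h | h
      · simpa [← h] using h0 i
      · refine h1 i ?_
        rw [mem_ball_zero_iff, norm_smul, Real.norm_of_nonneg (div_nonneg (hR i) hS),
          div_mul_eq_mul_div, div_lt_iff₀ hpos]
        exact mul_lt_mul_of_pos_left hx h
    · rw [← Finset.sum_smul, ← Finset.sum_div, div_self hpos.ne', one_smul]

/-- The radius of the ball in `ℝⁿ` with the same volume as `A`. -/
noncomputable def volRadius (A : Set (EuclideanSpace ℝ (Fin n))) : ℝ :=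
  ((volume A).toReal / (volume (Metric.ball (0 : EuclideanSpace ℝ (Fin n)) 1)).toReal) ^ ((n : ℝ)⁻¹)

theorem volume_unitBall_toReal_pos :
    0 < (volume (Metric.ball (0 : EuclideanSpace ℝ (Fin n)) 1)).toReal :=
  ENNReal.toReal_pos (Metric.measure_ball_pos _ _ one_pos).ne' measure_ball_lt_top.ne

theorem volRadius_nonneg (A : Set (EuclideanSpace ℝ (Fin n))) : 0 ≤ volRadius A :=
  Real.rpow_nonneg (div_nonneg ENNReal.toReal_nonneg ENNReal.toReal_nonneg) _

theorem volume_closedBall_volRadius (hn : n ≠ 0) {A : Set (EuclideanSpace ℝ (Fin n))}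
    (hA : volume A ≠ ∞) :
    volume (Metric.closedBall (0 : EuclideanSpace ℝ (Fin n)) (volRadius A)) = volume A := by
  rw [volume_closedBall_eq _ (volRadius_nonneg A), volRadius, Real.rpow_inv_natCast_pow
    (div_nonneg ENNReal.toReal_nonneg ENNReal.toReal_nonneg) hn,
    ENNReal.ofReal_div_of_pos volume_unitBall_toReal_pos, ENNReal.ofReal_toReal hA,
    ENNReal.ofReal_toReal measure_ball_lt_top.ne]
  exact ENNReal.div_mul_cancel (Metric.measure_ball_pos _ _ one_pos).ne' measure_ball_lt_top.ne

theorem volRadius_mono {A A' : Set (EuclideanSpace ℝ (Fin n))} (h : A ⊆ A') (hA : volume A' ≠ ∞) :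
    volRadius A ≤ volRadius A' := by
  unfold volRadius
  gcongr

theorem altSum_volume_balls_le (hn : n ≠ 0) {A B : Fin n → Set (EuclideanSpace ℝ (Fin n))}
    (hA : ∀ i, Convex ℝ (A i)) (hb : ∀ i, Bornology.IsBounded (A i)) (hne : ∀ i, (A i).Nonempty)
    (h0 : ∀ i, 0 ∈ B i) (h1 : ∀ i, Metric.ball 0 (volRadius (A i)) ⊆ B i)
    (h2 : ∀ i, B i ⊆ Metric.closedBall 0 (volRadius (A i))) :
    (altSum fun S => (volume (∑ i ∈ S, B i)).toReal) ≤
      altSum fun S => (volume (∑ i ∈ S, A i)).toReal := by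
  refine le_trans (le_of_eq ?_) (factorial_mul_prod_le_altSum hn hA hb hne)
  have hR := fun i => volRadius_nonneg (A i)
  simp only [volume_sum_of_ball_subset hn _ hR h0 h1 h2, ENNReal.toReal_mul]
  simp only [ENNReal.toReal_ofReal (pow_nonneg (Finset.sum_nonneg fun i _ => hR i) n)]
  simp only [mul_comm _ (volume (Metric.ball (0 : EuclideanSpace ℝ (Fin n)) 1)).toReal]
  rw [altSum_const_mul, altSum_pow_sum, mul_left_comm]
  congr 1
  unfold volRadius
  rw [← prod_mul_rpow_inv hn ENNReal.toReal_nonneg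
    fun i => div_nonneg ENNReal.toReal_nonneg ENNReal.toReal_nonneg]
  simp only [mul_div_cancel₀ _ volume_unitBall_toReal_pos.ne']

theorem volume_sum_balls_le (hn : n ≠ 0) (S : Finset (Fin n))
    {A B : Fin n → Set (EuclideanSpace ℝ (Fin n))} (hb : volume (∑ i, A i) ≠ ∞)
    (h0A : ∀ i, 0 ∈ A i)
    (h0 : ∀ i, 0 ∈ B i) (h1 : ∀ i, Metric.ball 0 (volRadius (A i)) ⊆ B i)
    (h2 : ∀ i, B i ⊆ Metric.closedBall 0 (volRadius (A i))) :
    volume (∑ i ∈ S, B i) ≤ ENNReal.ofReal ((n : ℝ) ^ n) * volume (∑ i, A i) := by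
  have hR := fun i => volRadius_nonneg (A i)
  rw [volume_sum_of_ball_subset hn S hR h0 h1 h2, ← volume_closedBall_volRadius hn hb,
    volume_closedBall_eq _ (volRadius_nonneg _), ← mul_assoc,
    ← ENNReal.ofReal_mul (by positivity), ← mul_pow]
  gcongr
  · exact Finset.sum_nonneg fun i _ => hR i
  have hsub : ∀ i, A i ⊆ ∑ i, A i := fun i => by
    simpa using finset_sum_subset_of_zero_mem (Finset.subset_univ {i}) h0A
  refine (Finset.sum_le_card_nsmul S _ _ fun i _ => volRadius_mono (hsub i) hb).trans ?_
  rw [nsmul_eq_mul]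
  gcongr
  · exact volRadius_nonneg _
  · simpa using S.card_le_univ

end Euclidean

section LevelSets

variable {n m : ℕ}

theorem QuasiConcave.convex_setOf_lt {g : En n → ℝ≥0∞} (hg : QuasiConcave g) (t : ℝ≥0∞) :
    Convex ℝ {x | t < g x} := by
  rw [convex_iff_forall_pos]
  intro x hx y hy a b ha hb hab
  obtain rfl : b = 1 - a := by linarith
  exact (lt_min hx hy).trans_le (hg x y a ha (by linarith))

theorem setOf_lt_oplusFinset (S : Finset (Fin m)) (g : Fin m → En n → ℝ≥0∞) {s : ℝ≥0∞}
    (hs : s ≠ ∞) : {x | s < oplusFinset S g x} = ∑ i ∈ S, {x | s < g i x} := by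
  ext x
  simp only [Set.mem_ofPred_eq, oplusFinset, lt_iSup_iff, Set.mem_finsetSum, exists_prop,
    ← Finset.inf_eq_iInf, Finset.lt_inf_iff hs.lt_top]
  exact exists_congr fun y => and_comm

theorem oplusFinset_le_one {S : Finset (Fin m)} (hS : S.Nonempty) {g : Fin m → En n → ℝ≥0∞}
    (h1 : ∀ i x, g i x ≤ 1) (x : En n) : oplusFinset S g x ≤ 1 := by
  obtain ⟨i, hi⟩ := hS
  exact iSup₂_le fun y _ => (iInf₂_le i hi).trans (h1 i _)

/-- The volume of the Minkowski sum of the superlevel sets at height `t`. -/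
def levelVolume (g : Fin m → En n → ℝ≥0∞) (S : Finset (Fin m)) (t : ℝ) : ℝ≥0∞ :=
  volume (∑ i ∈ S, {x | ENNReal.ofReal t < g i x})

theorem levelVolume_antitone (g : Fin m → En n → ℝ≥0∞) (S : Finset (Fin m)) :
    Antitone (levelVolume g S) := fun _ _ hst =>
  measure_mono (finset_sum_subset_sum S fun _ _ _ hx => (ENNReal.ofReal_le_ofReal hst).trans_lt hx)

theorem nullMeasurableSet_lt_oplusFinset (S : Finset (Fin m)) {g : Fin m → En n → ℝ≥0∞}
    (hq : ∀ i, QuasiConcave (g i)) (s : ℝ≥0∞) :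
    NullMeasurableSet {x | s < oplusFinset S g x} := by
  rcases eq_or_ne s ∞ with rfl | hs
  · simp
  · rw [setOf_lt_oplusFinset S g hs]
    exact (convex_finset_sum S fun i => (hq i).convex_setOf_lt s).nullMeasurableSet (μ := volume)

theorem lintegral_oplusFinset {S : Finset (Fin m)} (hS : S.Nonempty) {g : Fin m → En n → ℝ≥0∞}
    (hq : ∀ i, QuasiConcave (g i)) (h1 : ∀ i x, g i x ≤ 1) :
    ∫⁻ x, oplusFinset S g x = ∫⁻ t in Set.Ioo 0 1, levelVolume g S t := by
  have hle := oplusFinset_le_one hS h1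
  have htop : ∀ x, oplusFinset S g x ≠ ∞ := fun x => ne_top_of_le_ne_top one_ne_top (hle x)
  have hm : AEMeasurable (oplusFinset S g) :=
    NullMeasurable.aemeasurable (measurable_of_Ioi fun s => nullMeasurableSet_lt_oplusFinset S hq s)
  have h := lintegral_eq_lintegral_meas_lt volume
    (Eventually.of_forall fun x => ENNReal.toReal_nonneg) hm.ennreal_toReal
  simp only [ENNReal.ofReal_toReal (htop _)] at h
  rw [h, ← Set.Ioo_union_Ici_eq_Ioi one_pos,
    lintegral_union measurableSet_Ici (Set.disjoint_left.2 fun t ht ht' => ht.2.not_ge ht')]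
  have hz : ∫⁻ t in Set.Ici (1 : ℝ), volume {x | t < (oplusFinset S g x).toReal} = 0 := by
    rw [setLIntegral_congr_fun (g := 0) measurableSet_Ici fun t ht => ?_]
    · simp
    · have : {x | t < (oplusFinset S g x).toReal} = ∅ := Set.eq_empty_of_forall_notMem fun x hx =>
        (hx.trans_le (ENNReal.toReal_mono one_ne_top (hle x))).not_ge (by simpa using ht)
      simp [this]
  rw [hz, add_zero]
  refine setLIntegral_congr_fun measurableSet_Ioo fun t ht => ?_
  rw [levelVolume, ← setOf_lt_oplusFinset S g ENNReal.ofReal_ne_top]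
  simp only [ENNReal.ofReal_lt_iff_lt_toReal ht.1.le (htop _)]

end LevelSets

section Rearrangement

variable {n : ℕ}

theorem volume_closedBall_lt (hn : n ≠ 0) {r R : ℝ} (hr : 0 ≤ r) (h : r < R) :
    volume (Metric.closedBall (0 : En n) r) < volume (Metric.closedBall (0 : En n) R) := by
  rw [volume_closedBall_eq r hr, volume_closedBall_eq R (hr.trans h.le)]
  refine ENNReal.mul_lt_mul_left (Metric.measure_ball_pos _ _ one_pos).ne'
    measure_ball_lt_top.ne ?_
  exact (ENNReal.ofReal_lt_ofReal_iff_of_nonneg (pow_nonneg hr n)).2 (pow_lt_pow_left₀ h hr hn)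

theorem fstar_le_one (f : En n → ℝ≥0∞) (x : En n) : fstar f x ≤ 1 :=
  sSup_le fun _ ht => ht.1

theorem fstar_zero (hn : n ≠ 0) (f : En n → ℝ≥0∞) : fstar f 0 = 1 := by
  refine le_antisymm (fstar_le_one f 0) (le_sSup ⟨le_rfl, ?_⟩)
  rw [norm_zero, volume_closedBall_eq 0 le_rfl]
  simp [hn]

theorem fstar_le_fstar_of_norm_le (f : En n → ℝ≥0∞) {x y : En n} (h : ‖x‖ ≤ ‖y‖) :
    fstar f y ≤ fstar f x :=
  sSup_le_sSup fun _ ht =>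
    ⟨ht.1, (measure_mono (Metric.closedBall_subset_closedBall h)).trans ht.2⟩

theorem quasiConcave_fstar (f : En n → ℝ≥0∞) : QuasiConcave (fstar f) := by
  intro x y l h0 h1
  have hle : ‖l • x + (1 - l) • y‖ ≤ max ‖x‖ ‖y‖ := by
    refine (norm_add_le _ _).trans ?_
    rw [norm_smul, norm_smul, Real.norm_of_nonneg h0.le, Real.norm_of_nonneg (by linarith)]
    nlinarith [le_max_left ‖x‖ ‖y‖, le_max_right ‖x‖ ‖y‖]
  rcases le_total ‖x‖ ‖y‖ with h | h
  · exact (min_le_right _ _).trans (fstar_le_fstar_of_norm_le f (hle.trans_eq (max_eq_right h)))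
  · exact (min_le_left _ _).trans (fstar_le_fstar_of_norm_le f (hle.trans_eq (max_eq_left h)))

theorem ball_volRadius_subset (hn : n ≠ 0) {f : En n → ℝ≥0∞} {s : ℝ≥0∞} (hs : s < 1)
    (hb : volume {x | s < f x} ≠ ∞) :
    Metric.ball 0 (volRadius {x | s < f x}) ⊆ {x | s < fstar f x} := by
  intro x hx
  rw [mem_ball_zero_iff] at hx
  have hlt := volume_closedBall_lt hn (norm_nonneg x) hx
  rw [volume_closedBall_volRadius hn hb] at hlt
  obtain ⟨u, hu, hmem, hlim⟩ := exists_seq_strictAnti_tendsto' hs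
  have hU : {x | s < f x} = ⋃ k, {x | u k ≤ f x} := by
    ext y
    rw [Set.mem_iUnion]
    refine ⟨fun hy => ?_, fun ⟨k, hk⟩ => (hmem k).1.trans_le hk⟩
    obtain ⟨k, hk⟩ := (hlim.eventually_lt_const hy).exists
    exact ⟨k, hk.le⟩
  have hmono : Monotone fun k => {x | u k ≤ f x} := fun j k hjk y hy => (hu.antitone hjk).trans hy
  rw [hU, hmono.measure_iUnion, lt_iSup_iff] at hlt
  obtain ⟨k, hk⟩ := hlt
  exact (hmem k).1.trans_le (le_sSup ⟨(hmem k).2.le, hk.le⟩)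

theorem subset_closedBall_volRadius (hn : n ≠ 0) {f : En n → ℝ≥0∞} {s : ℝ≥0∞}
    (hb : volume {x | s < f x} ≠ ∞) :
    {x | s < fstar f x} ⊆ Metric.closedBall 0 (volRadius {x | s < f x}) := by
  intro x hx
  obtain ⟨t, ht, hst⟩ := lt_sSup_iff.1 (show s < fstar f x from hx)
  rw [mem_closedBall_zero_iff]
  by_contra! hlt
  have h := volume_closedBall_lt hn (volRadius_nonneg _) hlt
  rw [volume_closedBall_volRadius hn hb] at h
  exact h.not_ge (ht.2.trans (measure_mono fun y hy => hst.trans_le hy))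

end Rearrangement

theorem mixedInt_eq_integral_altSum {n : ℕ} (hn : n ≠ 0) {g : Fin n → En n → ℝ≥0∞}
    (hq : ∀ i, QuasiConcave (g i)) (h1 : ∀ i x, g i x ≤ 1)
    (hfin : ∀ S : Finset (Fin n), ∫⁻ t in Set.Ioo 0 1, levelVolume g S t ≠ ∞) :
    mixedInt g = (n.factorial : ℝ)⁻¹ *
      ∫ t in Set.Ioo 0 1, altSum fun S => (levelVolume g S t).toReal := by
  have hm := fun S => (levelVolume_antitone g S).measurable.aemeasurable
    (μ := volume.restrict (Set.Ioo 0 1))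
  unfold altSum
  rw [integral_finsetSum _ fun S _ =>
    (integrable_toReal_of_lintegral_ne_top (hm S) (hfin S)).const_mul _]
  rw [mixedInt, Finset.powerset_univ, Finset.sum_filter]
  congr 1
  refine Finset.sum_congr rfl fun S _ => ?_
  rw [integral_const_mul, integral_toReal (hm S) (ae_lt_top' (hm S) (hfin S))]
  split_ifs with hS
  · rw [lintegral_oplusFinset hS hq h1]
  · obtain rfl := Finset.not_nonempty_iff_eq_empty.1 hS
    have h0 : volume (0 : Set (En n)) = 0 := by
      rw [← Set.singleton_zero, ← Metric.closedBall_zero, volume_closedBall_eq 0 le_rfl]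
      simp [hn]
    simp [levelVolume, h0]

theorem integrableOn_altSum_levelVolume {n : ℕ} {g : Fin n → En n → ℝ≥0∞}
    (hfin : ∀ S : Finset (Fin n), ∫⁻ t in Set.Ioo 0 1, levelVolume g S t ≠ ∞) :
    IntegrableOn (fun t => altSum fun S => (levelVolume g S t).toReal) (Set.Ioo 0 1) :=
  integrable_finsetSum _ fun S _ => (integrable_toReal_of_lintegral_ne_top
    (levelVolume_antitone g S).measurable.aemeasurable (hfin S)).const_mul _

theorem stmt9 (n : ℕ) (hn : 1 ≤ n) (f : Fin n → En n → ℝ≥0∞)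
    (hf : ∀ i, QC0 (f i))
    (hc : ∀ i, ∀ t : ℝ≥0∞, 0 < t → t ≤ 1 → IsCompact {x : En n | t ≤ f i x})
    (hfin : (∫⁻ x, oplusFinset Finset.univ f x) < ∞) :
    (∀ S : Finset (Fin n), S.Nonempty →
      (∫⁻ x, oplusFinset S f x) < ∞ ∧
      (∫⁻ x, oplusFinset S (fun i => fstar (f i)) x) < ∞) ∧
    mixedInt (fun i => fstar (f i)) ≤ mixedInt f := by
  have hn0 : n ≠ 0 := Nat.one_le_iff_ne_zero.1 hn
  have hne : (Finset.univ : Finset (Fin n)).Nonempty := ⟨⟨0, hn⟩, Finset.mem_univ _⟩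
  have hq : ∀ i, QuasiConcave (f i) := fun i => (hf i).1.2.1
  have h1 : ∀ i x, f i x ≤ 1 := fun i => (hf i).2.2
  have hq' : ∀ i, QuasiConcave (fstar (f i)) := fun i => quasiConcave_fstar _
  have h1' : ∀ i x, fstar (f i) x ≤ 1 := fun i => fstar_le_one _
  have hs : ∀ t ∈ Set.Ioo (0 : ℝ) 1, ENNReal.ofReal t < 1 := fun t ht => by
    simpa using ht.2
  have hb : ∀ t ∈ Set.Ioo (0 : ℝ) 1, ∀ i, Bornology.IsBounded {x | ENNReal.ofReal t < f i x} :=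
    fun t ht i => (hc i _ (ENNReal.ofReal_pos.2 ht.1) (hs t ht).le).isBounded.subset
      fun x (hx : _ < f i x) => hx.le
  have hbv : ∀ t ∈ Set.Ioo (0 : ℝ) 1, ∀ i, volume {x | ENNReal.ofReal t < f i x} ≠ ∞ :=
    fun t ht i => (hb t ht i).measure_lt_top.ne
  have h0 : ∀ t ∈ Set.Ioo (0 : ℝ) 1, ∀ i, (0 : En n) ∈ {x | ENNReal.ofReal t < f i x} :=
    fun t ht i => by simpa [(hf i).2.1] using ht.2
  have h0' : ∀ t ∈ Set.Ioo (0 : ℝ) 1, ∀ i, (0 : En n) ∈ {x | ENNReal.ofReal t < fstar (f i) x} :=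
    fun t ht i => by simpa [fstar_zero hn0] using ht.2
  have hin := fun t ht i => ball_volRadius_subset hn0 (hs t ht) (hbv t ht i)
  have hout := fun t ht i => subset_closedBall_volRadius hn0 (hbv t ht i)
  have hsum : ∀ t ∈ Set.Ioo (0 : ℝ) 1, levelVolume f Finset.univ t ≠ ∞ := fun t ht =>
    ((isCompact_finset_sum _ fun i => (hb t ht i).isCompact_closure).isBounded.subset
      (finset_sum_subset_sum Finset.univ fun i _ => subset_closure)).measure_lt_top.ne
  rw [lintegral_oplusFinset hne hq h1] at hfin
  have hF : ∀ S, ∫⁻ t in Set.Ioo 0 1, levelVolume f S t ≠ ∞ := fun S =>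
    ((setLIntegral_mono' measurableSet_Ioo fun t ht => measure_mono
      (finset_sum_subset_of_zero_mem (Finset.subset_univ S) (h0 t ht))).trans_lt hfin).ne
  have hF' : ∀ S, ∫⁻ t in Set.Ioo 0 1, levelVolume (fun i => fstar (f i)) S t ≠ ∞ := fun S => by
    refine ((setLIntegral_mono' measurableSet_Ioo fun t ht => volume_sum_balls_le hn0 S
      (hsum t ht) (h0 t ht) (h0' t ht) (hin t ht) (hout t ht)).trans_lt ?_).ne
    rw [lintegral_const_mul' _ _ ENNReal.ofReal_ne_top]
    exact ENNReal.mul_lt_top ENNReal.ofReal_lt_top hfin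
  refine ⟨fun S hS => ?_, ?_⟩
  · rw [lintegral_oplusFinset hS hq h1, lintegral_oplusFinset hS hq' h1']
    exact ⟨(hF S).lt_top, (hF' S).lt_top⟩
  rw [mixedInt_eq_integral_altSum hn0 hq h1 hF, mixedInt_eq_integral_altSum hn0 hq' h1' hF']
  refine mul_le_mul_of_nonneg_left ?_ (by positivity)
  refine setIntegral_mono_on (integrableOn_altSum_levelVolume hF')
    (integrableOn_altSum_levelVolume hF) measurableSet_Ioo fun t ht => ?_
  exact altSum_volume_balls_le hn0 (fun i => (hq i).convex_setOf_lt _) (hb t ht)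
    (fun i => ⟨0, h0 t ht i⟩) (h0' t ht) (hin t ht) (hout t ht)
end
end

section
/- Let n ≥ 1 and let f ∈ LC₀(ℝⁿ) have compact superlevel sets {f ≥ t} for every t ∈ (0,1]. Then its symmetric decreasing rearrangement f* is log-concave. -/
open MeasureTheory ENNReal Filter Topology

noncomputable section

/-- Log-concavity: `f(λx+(1−λ)y) ≥ f(x)^λ f(y)^{1−λ}`. -/
def LogConcaveE {n : ℕ} (f : En n → ℝ≥0∞) : Prop :=
  ∀ x y : En n, ∀ l : ℝ, 0 < l → l < 1 →
    f x ^ l * f y ^ (1 - l) ≤ f (l • x + (1 - l) • y)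

/-- `LC₀(ℝⁿ)`: upper semicontinuous log-concave functions with `max f = f 0 = 1`. -/
def LC0 {n : ℕ} (f : En n → ℝ≥0∞) : Prop :=
  UpperSemicontinuous f ∧ LogConcaveE f ∧ f 0 = 1 ∧ ∀ x, f x ≤ 1

open scoped Pointwise

/-- The one-dimensional Brunn–Minkowski inequality for compact sets. -/
theorem volume_add_volume_le_of_isCompact {K L C : Set ℝ} (hK : IsCompact K) (hL : IsCompact L)
    (hK0 : K.Nonempty) (hL0 : L.Nonempty) (h : ∀ a ∈ K, ∀ b ∈ L, a + b ∈ C) :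
    volume K + volume L ≤ volume C := by
  obtain ⟨a, ha, haK⟩ := hK.exists_isGreatest hK0
  obtain ⟨b, hb, hbL⟩ := hL.exists_isLeast hL0
  have hinter : ((fun x => x + -b) ⁻¹' K) ∩ ((fun x => -a + x) ⁻¹' L) ⊆ {a + b} := by
    rintro x ⟨h1, h2⟩
    have h3 := haK h1
    have h4 := hbL h2
    simp only [Set.mem_singleton_iff]
    linarith
  have hunion : ((fun x => x + -b) ⁻¹' K) ∪ ((fun x => -a + x) ⁻¹' L) ⊆ C := by
    rintro x (h1 | h1)
    · simpa using h _ h1 _ hb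
    · simpa using h _ ha _ h1
  have hL' : MeasurableSet ((fun x => -a + x) ⁻¹' L) := hL.measurableSet.preimage (by fun_prop)
  calc volume K + volume L
      = volume ((fun x => x + -b) ⁻¹' K) + volume ((fun x => -a + x) ⁻¹' L) := by
        rw [measure_preimage_add_right, measure_preimage_add]
    _ = volume (((fun x => x + -b) ⁻¹' K) ∪ ((fun x => -a + x) ⁻¹' L)) := by
        rw [← measure_union_add_inter _ hL',
          measure_mono_null hinter Real.volume_singleton, add_zero]
    _ ≤ volume C := measure_mono hunion

/-- The one-dimensional Brunn–Minkowski inequality for measurable sets. -/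
theorem volume_add_volume_le {A B C : Set ℝ} (hA : MeasurableSet A) (hB : MeasurableSet B)
    (hA0 : A.Nonempty) (hB0 : B.Nonempty) (h : ∀ a ∈ A, ∀ b ∈ B, a + b ∈ C) :
    volume A + volume B ≤ volume C := by
  obtain ⟨a, ha⟩ := hA0
  obtain ⟨b, hb⟩ := hB0
  have inner : ∀ S : Set ℝ, MeasurableSet S →
      volume S = ⨆ K, ⨆ _ : K ⊆ S ∧ IsCompact K, volume K := fun S hS => by
    simp only [hS.measure_eq_iSup_isCompact, iSup_and]
  rw [inner A hA, inner B hB]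
  refine ENNReal.biSup_add_biSup_le' ⟨∅, by simp⟩ ⟨∅, by simp⟩ ?_
  rintro K ⟨hKA, hK⟩ L ⟨hLB, hL⟩
  refine (add_le_add (measure_mono (Set.subset_insert a K))
    (measure_mono (Set.subset_insert b L))).trans ?_
  exact volume_add_volume_le_of_isCompact (hK.insert a) (hL.insert b) (Set.insert_nonempty _ _)
    (Set.insert_nonempty _ _) fun x hx y hy =>
      h x (Set.insert_subset ha hKA hx) y (Set.insert_subset hb hLB hy)

theorem volume_convex_comb_le {A B C : Set ℝ} (hA : MeasurableSet A) (hB : MeasurableSet B)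
    (hA0 : A.Nonempty) (hB0 : B.Nonempty) {l : ℝ} (hl0 : 0 < l) (hl1 : l < 1)
    (h : ∀ a ∈ A, ∀ b ∈ B, l * a + (1 - l) * b ∈ C) :
    ENNReal.ofReal l * volume A + ENNReal.ofReal (1 - l) * volume B ≤ volume C := by
  have hl2 : 0 < 1 - l := by linarith
  have := volume_add_volume_le (hA.const_smul_of_ne_zero hl0.ne')
    (hB.const_smul_of_ne_zero hl2.ne') (hA0.smul_set (a := l)) (hB0.smul_set (a := 1 - l))
    (C := C) (by rintro _ ⟨a, ha, rfl⟩ _ ⟨b, hb, rfl⟩; exact h a ha b hb)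
  simpa [Measure.addHaar_smul, abs_of_pos hl0, abs_of_pos hl2] using this

theorem lintegral_eq_lintegral_meas_ofReal_lt {α : Type*} [MeasurableSpace α] (μ : Measure α)
    {f : α → ℝ≥0∞} (hf : Measurable f) (hfin : ∀ x, f x ≠ ∞) :
    ∫⁻ x, f x ∂μ = ∫⁻ t in Set.Ioi (0 : ℝ), μ {x | ENNReal.ofReal t < f x} := by
  have h := lintegral_eq_lintegral_meas_lt μ (f := fun x => (f x).toReal)
    (Eventually.of_forall fun x => ENNReal.toReal_nonneg) hf.ennreal_toReal.aemeasurable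
  simp only [ENNReal.ofReal_toReal (hfin _)] at h
  rw [h]
  refine setLIntegral_congr_fun measurableSet_Ioi fun t ht => ?_
  simp only [ENNReal.ofReal_lt_iff_lt_toReal (le_of_lt ht) (hfin _)]

theorem ENNReal.geom_mean_le_arith_mean2_weighted (a b : ℝ≥0∞) {l : ℝ} (hl0 : 0 < l)
    (hl1 : l < 1) :
    a ^ l * b ^ (1 - l) ≤ ENNReal.ofReal l * a + ENNReal.ofReal (1 - l) * b := by
  have hl2 : 0 < 1 - l := by linarith
  have hpq : (l⁻¹).HolderConjugate (1 - l)⁻¹ :=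
    Real.holderConjugate_iff.2 ⟨(one_lt_inv₀ hl0).2 hl1, by simp⟩
  have := ENNReal.young_inequality (a ^ l) (b ^ (1 - l)) hpq
  rwa [← ENNReal.rpow_mul, ← ENNReal.rpow_mul, mul_inv_cancel₀ hl0.ne', mul_inv_cancel₀ hl2.ne',
    ENNReal.rpow_one, ENNReal.rpow_one, ENNReal.ofReal_inv_of_pos hl0,
    ENNReal.ofReal_inv_of_pos hl2, div_eq_mul_inv, div_eq_mul_inv, inv_inv, inv_inv,
    mul_comm a, mul_comm b] at this

/-- The Prékopa–Leindler inequality holds on the space `E`. -/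
def PrekopaLeindler (E : Type*) [AddCommGroup E] [Module ℝ E] [MeasureSpace E] : Prop :=
  ∀ f g h : E → ℝ≥0∞, Measurable f → Measurable g → Measurable h → ∀ l : ℝ, 0 < l → l < 1 →
    (∀ x y, f x ^ l * g y ^ (1 - l) ≤ h (l • x + (1 - l) • y)) →
    (∫⁻ x, f x) ^ l * (∫⁻ x, g x) ^ (1 - l) ≤ ∫⁻ x, h x

theorem lintegral_prekopaLeindler_of_iSup_eq_one {f g h : ℝ → ℝ≥0∞} (hf : Measurable f)
    (hg : Measurable g) (hh : Measurable h) (hf1 : ⨆ x, f x = 1) (hg1 : ⨆ x, g x = 1) {l : ℝ}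
    (hl0 : 0 < l) (hl1 : l < 1)
    (hfgh : ∀ x y, f x ^ l * g y ^ (1 - l) ≤ h (l * x + (1 - l) * y)) :
    (∫⁻ x, f x) ^ l * (∫⁻ x, g x) ^ (1 - l) ≤ ∫⁻ x, h x := by
  have hl2 : 0 < 1 - l := by linarith
  have hf2 : ∀ x, f x ≤ 1 := fun x => hf1 ▸ le_iSup f x
  have hg2 : ∀ x, g x ≤ 1 := fun x => hg1 ▸ le_iSup g x
  have hmeas : ∀ u : ℝ → ℝ≥0∞, Measurable fun t : ℝ => volume {x | ENNReal.ofReal t < u x} :=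
    fun u => Antitone.measurable fun s t hst =>
      measure_mono fun x hx => (ENNReal.ofReal_le_ofReal hst).trans_lt hx
  refine (ENNReal.geom_mean_le_arith_mean2_weighted _ _ hl0 hl1).trans ?_
  refine le_trans ?_ (lintegral_mono (fun x => min_le_left (h x) 1))
  rw [lintegral_eq_lintegral_meas_ofReal_lt _ hf fun x => ((hf2 x).trans_lt one_lt_top).ne,
    lintegral_eq_lintegral_meas_ofReal_lt _ hg fun x => ((hg2 x).trans_lt one_lt_top).ne,
    lintegral_eq_lintegral_meas_ofReal_lt _ (hh.min measurable_const)
      fun x => ((min_le_right (h x) 1).trans_lt one_lt_top).ne,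
    ← lintegral_const_mul _ (hmeas f), ← lintegral_const_mul _ (hmeas g),
    ← lintegral_add_left ((hmeas f).const_mul _)]
  refine lintegral_mono fun t => ?_
  rcases lt_or_ge (ENNReal.ofReal t) 1 with ht | ht
  · obtain ⟨a, ha⟩ := lt_iSup_iff.1 (hf1 ▸ ht : ENNReal.ofReal t < ⨆ x, f x)
    obtain ⟨b, hb⟩ := lt_iSup_iff.1 (hg1 ▸ ht : ENNReal.ofReal t < ⨆ x, g x)
    refine volume_convex_comb_le (hf measurableSet_Ioi) (hg measurableSet_Ioi) ⟨a, ha⟩ ⟨b, hb⟩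
      hl0 hl1 fun x hx y hy => ?_
    refine lt_min (lt_of_lt_of_le ?_ (hfgh x y)) ht
    calc ENNReal.ofReal t = ENNReal.ofReal t ^ l * ENNReal.ofReal t ^ (1 - l) := by
          rw [← ENNReal.rpow_add_of_nonneg _ _ hl0.le hl2.le]; simp
      _ < f x ^ l * g y ^ (1 - l) :=
          ENNReal.mul_lt_mul (ENNReal.rpow_lt_rpow hx hl0) (ENNReal.rpow_lt_rpow hy hl2)
  · simp [fun x => ((hf2 x).trans ht).not_gt, fun x => ((hg2 x).trans ht).not_gt]

theorem lintegral_prekopaLeindler_of_bounded {f g h : ℝ → ℝ≥0∞} (hf : Measurable f)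
    (hg : Measurable g) (hh : Measurable h) (hf1 : ⨆ x, f x ≠ ∞) (hg1 : ⨆ x, g x ≠ ∞) {l : ℝ}
    (hl0 : 0 < l) (hl1 : l < 1)
    (hfgh : ∀ x y, f x ^ l * g y ^ (1 - l) ≤ h (l * x + (1 - l) * y)) :
    (∫⁻ x, f x) ^ l * (∫⁻ x, g x) ^ (1 - l) ≤ ∫⁻ x, h x := by
  have hl2 : 0 < 1 - l := by linarith
  set M := ⨆ x, f x with hM
  set N := ⨆ x, g x with hN
  by_cases hM0 : M = 0
  · have : ∀ x, f x = 0 := fun x => le_antisymm (hM0 ▸ le_iSup f x) bot_le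
    simp [this, hl0]
  by_cases hN0 : N = 0
  · have : ∀ x, g x = 0 := fun x => le_antisymm (hN0 ▸ le_iSup g x) bot_le
    simp [this, hl2]
  set P := M ^ l * N ^ (1 - l) with hP
  have hP0 : P ≠ 0 := by simp [hP, hM0, hN0, hf1, hg1]
  have hP1 : P ≠ ∞ := ENNReal.mul_ne_top (ENNReal.rpow_ne_top_of_nonneg hl0.le hf1)
    (ENNReal.rpow_ne_top_of_nonneg hl2.le hg1)
  have hPinv : (M⁻¹) ^ l * (N⁻¹) ^ (1 - l) = P⁻¹ := by
    rw [ENNReal.inv_rpow, ENNReal.inv_rpow, hP, ENNReal.mul_inv]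
    · exact Or.inr (ENNReal.rpow_ne_top_of_nonneg hl2.le hg1)
    · exact Or.inl (ENNReal.rpow_ne_top_of_nonneg hl0.le hf1)
  have hmul : ∀ a b : ℝ≥0∞, (M⁻¹ * a) ^ l * (N⁻¹ * b) ^ (1 - l)
      = P⁻¹ * (a ^ l * b ^ (1 - l)) := fun a b => by
    rw [ENNReal.mul_rpow_of_nonneg _ _ hl0.le, ENNReal.mul_rpow_of_nonneg _ _ hl2.le, ← hPinv]
    ring
  have key := lintegral_prekopaLeindler_of_iSup_eq_one (f := fun x => M⁻¹ * f x)
    (g := fun x => N⁻¹ * g x) (h := fun x => P⁻¹ * h x) (hf.const_mul _) (hg.const_mul _)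
    (hh.const_mul _) (by rw [← ENNReal.mul_iSup, ← hM, ENNReal.inv_mul_cancel hM0 hf1])
    (by rw [← ENNReal.mul_iSup, ← hN, ENNReal.inv_mul_cancel hN0 hg1]) hl0 hl1
    (fun x y => by rw [hmul]; gcongr; exact hfgh x y)
  rw [lintegral_const_mul _ hf, lintegral_const_mul _ hg, lintegral_const_mul _ hh, hmul] at key
  exact (ENNReal.mul_le_mul_iff_right (ENNReal.inv_ne_zero.2 hP1) (ENNReal.inv_ne_top.2 hP0)).1 key

theorem tendsto_lintegral_min_natCast {α : Type*} [MeasurableSpace α] (μ : Measure α)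
    {f : α → ℝ≥0∞} (hf : Measurable f) :
    Tendsto (fun k : ℕ => ∫⁻ x, min (f x) k ∂μ) atTop (𝓝 (∫⁻ x, f x ∂μ)) := by
  refine lintegral_tendsto_of_tendsto_of_monotone
    (fun k => (hf.min measurable_const).aemeasurable)
    (Eventually.of_forall fun x i j hij => min_le_min le_rfl (by exact_mod_cast hij))
    (Eventually.of_forall fun x => ?_)
  have := (tendsto_const_nhds (x := f x)).min ENNReal.tendsto_nat_nhds_top
  simpa using this

theorem prekopaLeindler_real : PrekopaLeindler ℝ := by
  intro f g h hf hg hh l hl0 hl1 hfgh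
  have hl2 : 0 < 1 - l := by linarith
  by_cases hf0 : ∫⁻ x, f x = 0
  · simp [hf0, hl0]
  by_cases hg0 : ∫⁻ x, g x = 0
  · simp [hg0, hl2]
  have hlim := ENNReal.Tendsto.mul
    (((ENNReal.continuous_rpow_const (y := l)).tendsto _).comp
      (tendsto_lintegral_min_natCast volume hf))
    (Or.inl (by simp [ENNReal.rpow_eq_zero_iff, hf0, hl0.not_gt]))
    (((ENNReal.continuous_rpow_const (y := 1 - l)).tendsto _).comp
      (tendsto_lintegral_min_natCast volume hg))
    (Or.inl (by simp [ENNReal.rpow_eq_zero_iff, hg0, hl1.le]))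
  have hbdd : ∀ (u : ℝ → ℝ≥0∞) (k : ℕ), ⨆ x, min (u x) k ≠ ∞ := fun u k =>
    ((iSup_le fun x => min_le_right _ _).trans_lt (ENNReal.natCast_lt_top k)).ne
  refine le_of_tendsto' hlim fun k => ?_
  refine lintegral_prekopaLeindler_of_bounded (hf.min measurable_const) (hg.min measurable_const)
    hh (hbdd f k) (hbdd g k) hl0 hl1 fun x y => le_trans ?_ (hfgh x y)
  gcongr <;> exact min_le_left _ _

theorem PrekopaLeindler.prod {E F : Type*} [AddCommGroup E] [Module ℝ E] [MeasureSpace E]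
    [AddCommGroup F] [Module ℝ F] [MeasureSpace F] [SFinite (volume : Measure F)]
    (hE : PrekopaLeindler E) (hF : PrekopaLeindler F) : PrekopaLeindler (E × F) := by
  intro f g h hf hg hh l hl0 hl1 hfgh
  rw [Measure.volume_eq_prod, lintegral_prod _ hf.aemeasurable, lintegral_prod _ hg.aemeasurable,
    lintegral_prod _ hh.aemeasurable]
  refine hE _ _ _ hf.lintegral_prod_right' hg.lintegral_prod_right' hh.lintegral_prod_right'
    l hl0 hl1 fun x y => ?_
  exact hF _ _ _ (hf.comp measurable_prodMk_left) (hg.comp measurable_prodMk_left)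
    (hh.comp measurable_prodMk_left) l hl0 hl1 fun u v => hfgh (x, u) (y, v)

theorem PrekopaLeindler.of_measurePreserving {E F : Type*} [AddCommGroup E] [Module ℝ E]
    [MeasureSpace E] [AddCommGroup F] [Module ℝ F] [MeasureSpace F] (hE : PrekopaLeindler E)
    (e : E →ₗ[ℝ] F) (he : MeasurePreserving e) : PrekopaLeindler F := by
  intro f g h hf hg hh l hl0 hl1 hfgh
  rw [← he.lintegral_comp hf, ← he.lintegral_comp hg, ← he.lintegral_comp hh]
  refine hE _ _ _ (hf.comp he.measurable) (hg.comp he.measurable) (hh.comp he.measurable)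
    l hl0 hl1 fun x y => ?_
  simpa using hfgh (e x) (e y)

theorem prekopaLeindler_pi (n : ℕ) : PrekopaLeindler (Fin n → ℝ) := by
  induction n with
  | zero =>
    intro f g h hf hg hh l hl0 hl1 hfgh
    have := hfgh 0 0
    simpa [volume_pi, Measure.pi_of_empty _ (0 : Fin 0 → ℝ), lintegral_dirac' _ hf,
      lintegral_dirac' _ hg, lintegral_dirac' _ hh] using this
  | succ n ih =>
    let e : (ℝ × (Fin n → ℝ)) →ₗ[ℝ] (Fin (n + 1) → ℝ) :=
      (Fin.consLinearEquiv ℝ fun _ => ℝ).toLinearMap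
    refine (prekopaLeindler_real.prod ih).of_measurePreserving e ?_
    have he : ⇑e = (MeasurableEquiv.piFinSuccAbove (fun _ : Fin (n + 1) => ℝ) 0).symm := by
      ext p i
      refine Fin.cases ?_ (fun i => ?_) i <;> simp [e]
    rw [he]
    exact (volume_preserving_piFinSuccAbove (fun _ : Fin (n + 1) => ℝ) 0).symm

theorem prekopaLeindler_euclideanSpace (n : ℕ) : PrekopaLeindler (EuclideanSpace ℝ (Fin n)) :=
  (prekopaLeindler_pi n).of_measurePreserving
    (WithLp.linearEquiv 2 ℝ (Fin n → ℝ)).symm.toLinearMap (PiLp.volume_preserving_toLp (Fin n))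

/-- The multiplicative Brunn–Minkowski inequality. -/
theorem PrekopaLeindler.volume_rpow_mul_le {E : Type*} [AddCommGroup E] [Module ℝ E]
    [MeasureSpace E] (hE : PrekopaLeindler E) {A B C : Set E} (hA : MeasurableSet A)
    (hB : MeasurableSet B) (hC : MeasurableSet C) {l : ℝ} (hl0 : 0 < l) (hl1 : l < 1)
    (h : ∀ a ∈ A, ∀ b ∈ B, l • a + (1 - l) • b ∈ C) :
    volume A ^ l * volume B ^ (1 - l) ≤ volume C := by
  have hl2 : 0 < 1 - l := by linarith
  have := hE (A.indicator 1) (B.indicator 1) (C.indicator 1) (measurable_one.indicator hA)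
    (measurable_one.indicator hB) (measurable_one.indicator hC) l hl0 hl1 fun x y => by
      by_cases hx : x ∈ A
      · by_cases hy : y ∈ B
        · simp [hx, hy, h x hx y hy]
        · simp [hy, hl2]
      · simp [hx, hl0]
  rwa [lintegral_indicator_one hA, lintegral_indicator_one hB, lintegral_indicator_one hC] at this

section EuclideanSpace

variable {n : ℕ}

theorem volume_inv_smul_ge {A : Set (EuclideanSpace ℝ (Fin n))} {r : ℝ} (hr : 0 < r)
    (hA : volume (Metric.closedBall (0 : EuclideanSpace ℝ (Fin n)) r) ≤ volume A) :
    volume (Metric.closedBall (0 : EuclideanSpace ℝ (Fin n)) 1) ≤ volume (r⁻¹ • A) := by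
  rw [Measure.addHaar_smul_of_nonneg _ (inv_nonneg.2 hr.le)]
  refine le_trans (le_of_eq ?_) (mul_le_mul_right hA _)
  rw [← Measure.addHaar_smul_of_nonneg _ (inv_nonneg.2 hr.le),
    smul_closedBall _ _ hr.le, smul_zero, Real.norm_of_nonneg (inv_nonneg.2 hr.le),
    inv_mul_cancel₀ hr.ne']

/-- The Brunn–Minkowski inequality, with volumes compared to those of balls. -/
theorem volume_closedBall_convex_comb_le {A B C : Set (EuclideanSpace ℝ (Fin n))}
    (hA : MeasurableSet A) (hB : MeasurableSet B) (hC : MeasurableSet C) (hA0 : A.Nonempty)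
    (hB0 : B.Nonempty) {l a b : ℝ} (hl0 : 0 < l) (hl1 : l < 1) (ha : 0 ≤ a) (hb : 0 ≤ b)
    (hAa : volume (Metric.closedBall (0 : EuclideanSpace ℝ (Fin n)) a) ≤ volume A)
    (hBb : volume (Metric.closedBall (0 : EuclideanSpace ℝ (Fin n)) b) ≤ volume B)
    (h : ∀ x ∈ A, ∀ y ∈ B, l • x + (1 - l) • y ∈ C) :
    volume (Metric.closedBall (0 : EuclideanSpace ℝ (Fin n)) (l * a + (1 - l) * b))
      ≤ volume C := by
  have hl2 : 0 < 1 - l := by linarith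
  have translate : ∀ {D : Set (EuclideanSpace ℝ (Fin n))} {r s : ℝ}
      (v : EuclideanSpace ℝ (Fin n)), 0 < s →
      volume (Metric.closedBall (0 : EuclideanSpace ℝ (Fin n)) r) ≤ volume D → 0 ≤ r →
      (∀ y ∈ D, v + s • y ∈ C) →
      volume (Metric.closedBall (0 : EuclideanSpace ℝ (Fin n)) (s * r)) ≤ volume C := by
    intro D r s v hs hD hr hDC
    have hsub : s • D ⊆ (fun x => v + x) ⁻¹' C := by
      rintro _ ⟨y, hy, rfl⟩
      exact hDC y hy
    refine le_trans ?_ ((measure_mono hsub).trans_eq (measure_preimage_add _ _ _))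
    rw [Measure.addHaar_smul_of_nonneg _ hs.le]
    refine le_trans (le_of_eq ?_) (mul_le_mul_right hD _)
    rw [← Measure.addHaar_smul_of_nonneg _ hs.le, smul_closedBall _ _ hr, smul_zero,
      Real.norm_of_nonneg hs.le]
  rcases ha.eq_or_lt with rfl | ha
  · obtain ⟨x, hx⟩ := hA0
    simpa using translate (l • x) hl2 hBb hb fun y hy => h x hx y hy
  rcases hb.eq_or_lt with rfl | hb
  · obtain ⟨y, hy⟩ := hB0
    simpa using translate ((1 - l) • y) hl0 hAa ha.le fun x hx => by
      rw [add_comm]; exact h x hx y hy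
  set c := l * a + (1 - l) * b with hc
  have hc0 : 0 < c := by positivity
  have hm : 1 - l * a / c = (1 - l) * b / c := by field_simp; rw [hc]; ring
  have hm1 : l * a / c < 1 := by
    have : 0 < (1 - l) * b / c := by positivity
    linarith
  have key := (prekopaLeindler_euclideanSpace n).volume_rpow_mul_le
    (hA.const_smul_of_ne_zero (inv_ne_zero ha.ne')) (hB.const_smul_of_ne_zero (inv_ne_zero hb.ne'))
    (hC.const_smul_of_ne_zero (inv_ne_zero hc0.ne')) (l := l * a / c) (by positivity) hm1 (by
      rintro _ ⟨x, hx, rfl⟩ _ ⟨y, hy, rfl⟩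
      refine ⟨_, h x hx y hy, ?_⟩
      simp only [hm, smul_add, smul_smul]
      congr 2 <;> field_simp)
  have hball : volume (Metric.closedBall (0 : EuclideanSpace ℝ (Fin n)) 1)
      ≤ volume (c⁻¹ • C) := by
    refine le_trans ?_ key
    calc volume (Metric.closedBall (0 : EuclideanSpace ℝ (Fin n)) 1)
        = volume (Metric.closedBall (0 : EuclideanSpace ℝ (Fin n)) 1) ^ (l * a / c)
          * volume (Metric.closedBall (0 : EuclideanSpace ℝ (Fin n)) 1) ^ (1 - l * a / c) := by
          rw [← ENNReal.rpow_add_of_nonneg _ _ (by positivity) (by linarith)]; simp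
      _ ≤ _ := mul_le_mul' (ENNReal.rpow_le_rpow (volume_inv_smul_ge ha hAa) (by positivity))
          (ENNReal.rpow_le_rpow (volume_inv_smul_ge hb hBb) (by linarith))
  simpa using translate 0 hc0 hball zero_le_one (by
    rintro _ ⟨x, hx, rfl⟩
    simpa [smul_smul, hc0.ne'] using hx)

end EuclideanSpace

theorem stmt10 (n : ℕ) (hn : 1 ≤ n) (f : En n → ℝ≥0∞) (hf : LC0 f)
    (hcpt : ∀ t : ℝ≥0∞, 0 < t → t ≤ 1 → IsCompact {x : En n | t ≤ f x}) :
    LogConcaveE (fstar f) := by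
  obtain ⟨-, hlc, hf0, -⟩ := hf
  intro x y l hl0 hl1
  have hl2 : 0 < 1 - l := by linarith
  refine ENNReal.mul_le_of_forall_lt fun s' hs' t' ht' => ?_
  rw [← ENNReal.rpow_inv_lt_iff hl0] at hs'
  rw [← ENNReal.rpow_inv_lt_iff hl2] at ht'
  obtain ⟨s, ⟨hs1, hs⟩, hss⟩ := lt_sSup_iff.1 hs'
  obtain ⟨t, ⟨ht1, ht⟩, htt⟩ := lt_sSup_iff.1 ht'
  have hs0 : 0 < s := bot_le.trans_lt hss
  have ht0 : 0 < t := bot_le.trans_lt htt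
  rw [ENNReal.rpow_inv_lt_iff hl0] at hss
  rw [ENNReal.rpow_inv_lt_iff hl2] at htt
  refine (mul_le_mul' hss.le htt.le).trans ?_
  have hst0 : 0 < s ^ l * t ^ (1 - l) :=
    ENNReal.mul_pos (ENNReal.rpow_pos hs0 (hs1.trans_lt one_lt_top).ne).ne'
      (ENNReal.rpow_pos ht0 (ht1.trans_lt one_lt_top).ne).ne'
  have hst1 : s ^ l * t ^ (1 - l) ≤ 1 :=
    mul_le_one' (ENNReal.rpow_le_one hs1 hl0.le) (ENNReal.rpow_le_one ht1 hl2.le)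
  refine le_sSup ⟨hst1, ?_⟩
  refine le_trans (measure_mono (Metric.closedBall_subset_closedBall ?_))
    (volume_closedBall_convex_comb_le (hcpt s hs0 hs1).measurableSet
      (hcpt t ht0 ht1).measurableSet (hcpt _ hst0 hst1).measurableSet ⟨0, by simpa [hf0] using hs1⟩
      ⟨0, by simpa [hf0] using ht1⟩ hl0 hl1 (norm_nonneg x) (norm_nonneg y) hs ht
      fun u hu v hv => ?_)
  · refine (norm_add_le _ _).trans_eq ?_
    rw [norm_smul, norm_smul, Real.norm_of_nonneg hl0.le, Real.norm_of_nonneg hl2.le]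
  · exact (mul_le_mul' (ENNReal.rpow_le_rpow hu hl0.le) (ENNReal.rpow_le_rpow hv hl2.le)).trans
      (hlc u v l hl0 hl1)
end
end
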